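/- arXiv:1309.4588 — 2 statements merged into one kernel-verified Lean document; each statement's English description precedes it below -/
import Mathlib

section
/- (Gauss–Kuzmin theorem) Let μ be a non-atomic Borel probability measure on [0,1] whose distribution function F_{m,0}(x) = μ([0,x]) is twice continuously differentiable on [0,1], and define F_{m,n}(x) = μ({t : τ_mⁿ(t) ≤ x}) for n ≥ 1. Then there exist constants q ∈ (0,1) and C > 0 such that for all n ∈ ℕ and all x ∈ [0,1], |F_{m,n}(x) − ω_m(x)| ≤ C·qⁿ, where ω_m(x) = (k_m/(m−1)²)·log( m·((m−1)x+1)/((m−1)x+m) ) and k_m = (m−1)²/log(m²/(2m−1)). -/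
open MeasureTheory Set

/-- The Chan transformation `τ_m : [0,1] → [0,1]`: `τ_m(0) = 0` and, for
`x ∈ (m^{-(i+1)}, m^{-i}]` (equivalently `i = ⌊-log_m x⌋`),
`τ_m(x) = (1/(m-1)) (1/(mⁱ x) - 1)`. -/
noncomputable def chanTau (m : ℕ) (x : ℝ) : ℝ :=
  if x = 0 then 0
  else (1 / ((m : ℝ) - 1)) * (1 / ((m : ℝ) ^ ⌊-Real.logb m x⌋ * x) - 1)


/-- The normalizing constant `k_m = (m-1)^2 / log(m^2/(2m-1))`. -/
noncomputable def chanK (m : ℕ) : ℝ :=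
  ((m : ℝ) - 1) ^ 2 / Real.log ((m : ℝ) ^ 2 / (2 * (m : ℝ) - 1))

/-- The limiting distribution function
`ω_m(x) = (k_m/(m-1)^2) · log( m((m-1)x+1) / ((m-1)x+m) )`. -/
noncomputable def chanOmega (m : ℕ) (x : ℝ) : ℝ :=
  chanK m / ((m : ℝ) - 1) ^ 2 *
    Real.log ((m : ℝ) * (((m : ℝ) - 1) * x + 1) / (((m : ℝ) - 1) * x + (m : ℝ)))


/-- The scaled branch points `(m - 1) / mⁱ`. -/
noncomputable def branchScale (m : ℝ) (i : ℕ) : ℝ := (m - 1) / m ^ i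

/-- Branch probabilities of the normalized transfer operator, in the coordinate
`w = 1 + (m - 1) x`. -/
noncomputable def branchProb (m : ℝ) (i : ℕ) (w : ℝ) : ℝ :=
  w / (w + branchScale m (i + 1)) * ((w + (m - 1)) / (w + branchScale m i)) *
    branchScale m (i + 1)

/-- The inverse branches of the Chan map, in the coordinate `w = 1 + (m - 1) x`. -/
noncomputable def branchInv (m : ℝ) (i : ℕ) (w : ℝ) : ℝ := 1 + branchScale m i / w

/-- The transfer operator of the Chan map, normalized by its invariant density. -/
noncomputable def chanTransfer (m : ℝ) (g : ℝ → ℝ) (w : ℝ) : ℝ :=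
  ∑' i, branchProb m i w * g (branchInv m i w)

section Branches

variable {m : ℝ}

lemma branchScale_pos (hm : 2 ≤ m) (i : ℕ) : 0 < branchScale m i := by
  unfold branchScale
  have : 0 < m - 1 := by linarith
  positivity

lemma mul_branchScale_succ (hm : 2 ≤ m) (i : ℕ) :
    m * branchScale m (i + 1) = branchScale m i := by
  unfold branchScale
  have : m ≠ 0 := by linarith
  rw [pow_succ]
  field_simp

lemma branchScale_le (hm : 2 ≤ m) (i : ℕ) : branchScale m i ≤ m - 1 := by
  unfold branchScale
  exact div_le_self (by linarith) (one_le_pow₀ (by linarith))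

lemma branchScale_succ_le_one (hm : 2 ≤ m) (i : ℕ) : branchScale m (i + 1) ≤ 1 := by
  have h1 := mul_branchScale_succ hm i
  have h2 := branchScale_le hm i
  by_contra! h
  nlinarith

lemma hasSum_branchScale_succ (hm : 2 ≤ m) : HasSum (fun i => branchScale m (i + 1)) 1 := by
  have h0 : (0 : ℝ) < m := by linarith
  have h := (hasSum_geometric_of_lt_one (r := m⁻¹) (by positivity)
    (inv_lt_one_of_one_lt₀ (by linarith))).mul_left ((m - 1) / m)
  have h1 : m - 1 ≠ 0 := by linarith
  have h2 : (m - 1) / m * (1 - m⁻¹)⁻¹ = 1 := by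
    have : 1 - m⁻¹ = (m - 1) / m := by field_simp
    rw [this]
    field_simp
  rw [h2] at h
  have e : (fun i => branchScale m (i + 1)) = fun i => (m - 1) / m * m⁻¹ ^ i := by
    funext i
    unfold branchScale
    rw [pow_succ, inv_pow]
    field_simp
  rwa [e]

lemma branchProb_nonneg (hm : 2 ≤ m) (i : ℕ) {w : ℝ} (hw : 1 ≤ w) : 0 ≤ branchProb m i w := by
  unfold branchProb
  have h1 := branchScale_pos hm i
  have h2 := branchScale_pos hm (i + 1)
  have h3 : 0 < m - 1 := by linarith
  positivity

lemma branchFactor_le (hm : 2 ≤ m) (i : ℕ) {w : ℝ} (hw : 1 ≤ w) :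
    (w + (m - 1)) / (w + branchScale m i) ≤ m := by
  have h1 := branchScale_pos hm i
  rw [div_le_iff₀ (by linarith)]
  nlinarith

lemma branchProb_le (hm : 2 ≤ m) (i : ℕ) {w : ℝ} (hw : 1 ≤ w) :
    branchProb m i w ≤ m * branchScale m (i + 1) := by
  unfold branchProb
  have h1 := branchScale_pos hm i
  have h2 := branchScale_pos hm (i + 1)
  have h3 : w / (w + branchScale m (i + 1)) ≤ 1 := by
    rw [div_le_one (by linarith)]; linarith
  have h4 := branchFactor_le hm i hw
  have h5 : 0 ≤ (w + (m - 1)) / (w + branchScale m i) :=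
    div_nonneg (by linarith) (by linarith)
  have h6 : w / (w + branchScale m (i + 1)) * ((w + (m - 1)) / (w + branchScale m i)) ≤ 1 * m := by
    gcongr
  rw [one_mul] at h6
  gcongr

lemma le_branchProb (hm : 2 ≤ m) (i : ℕ) {w : ℝ} (hw : 1 ≤ w) :
    branchScale m (i + 1) / 2 ≤ branchProb m i w := by
  unfold branchProb
  have h1 := branchScale_pos hm i
  have h2 := branchScale_pos hm (i + 1)
  have h3 : 1 / 2 ≤ w / (w + branchScale m (i + 1)) := by
    have := branchScale_succ_le_one hm i
    rw [div_le_div_iff₀ (by norm_num) (by linarith)]; linarith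
  have h4 : 1 ≤ (w + (m - 1)) / (w + branchScale m i) := by
    have := branchScale_le hm i
    rw [one_le_div (by linarith)]; linarith
  have h5 : 1 / 2 * 1 ≤
      w / (w + branchScale m (i + 1)) * ((w + (m - 1)) / (w + branchScale m i)) := by
    gcongr
  nlinarith

lemma hasSum_branchProb (hm : 2 ≤ m) {w : ℝ} (hw : 1 ≤ w) :
    HasSum (fun i => branchProb m i w) 1 := by
  rw [hasSum_iff_tendsto_nat_of_nonneg (fun i => branchProb_nonneg hm i hw)]
  have hm1 : m - 1 ≠ 0 := by linarith
  have hpos := branchScale_pos hm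
  have key : ∀ i, branchProb m i w = w * (w + (m - 1)) / (m - 1) / (w + branchScale m (i + 1)) -
      w * (w + (m - 1)) / (m - 1) / (w + branchScale m i) := by
    intro i
    have h1 : w + branchScale m i ≠ 0 := by linarith [hpos i]
    have h2 : w + branchScale m (i + 1) ≠ 0 := by linarith [hpos (i + 1)]
    unfold branchProb
    have h3 : branchScale m i - branchScale m (i + 1) = (m - 1) * branchScale m (i + 1) := by
      linarith [mul_branchScale_succ hm i]
    have h4 : w * (w + (m - 1)) / (m - 1) * (w + branchScale m i) -
        (w + branchScale m (i + 1)) * (w * (w + (m - 1)) / (m - 1)) =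
        w * (w + (m - 1)) * branchScale m (i + 1) := by
      field_simp
      linear_combination (w + (m - 1)) * h3
    rw [div_sub_div _ _ h2 h1, h4]
    rw [div_mul_div_comm, div_mul_eq_mul_div]
  simp_rw [key, Finset.sum_range_sub (fun i => w * (w + (m - 1)) / (m - 1) / (w + branchScale m i))]
  have h0 : Filter.Tendsto (branchScale m) Filter.atTop (nhds 0) :=
    (Filter.tendsto_add_atTop_iff_nat 1).mp (hasSum_branchScale_succ hm).summable.tendsto_atTop_zero
  have hw0 : w ≠ 0 := by linarith
  have hwm : w + (m - 1) ≠ 0 := by linarith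
  have h := (tendsto_const_nhds (x := w * (w + (m - 1)) / (m - 1))).div (h0.const_add w)
    (by simpa using hw0) |>.sub_const (w * (w + (m - 1)) / (m - 1) / (w + branchScale m 0))
  have e : w * (w + (m - 1)) / (m - 1) / (w + 0) -
      w * (w + (m - 1)) / (m - 1) / (w + branchScale m 0) = 1 := by
    simp only [branchScale, pow_zero, div_one, add_zero]
    field_simp
    ring
  rwa [e] at h

lemma branchInv_mem (hm : 2 ≤ m) (i : ℕ) {w : ℝ} (hw : 1 ≤ w) :
    branchInv m i w ∈ Icc 1 m := by
  have h1 := branchScale_pos hm i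
  have h2 := branchScale_le hm i
  have h3 : branchScale m i / w ≤ branchScale m i := div_le_self h1.le hw
  have h4 : 0 ≤ branchScale m i / w := by positivity
  unfold branchInv
  constructor <;> linarith

lemma branchInv_anti (hm : 2 ≤ m) (i : ℕ) {v w : ℝ} (hv : 1 ≤ v) (hvw : v ≤ w) :
    branchInv m i w ≤ branchInv m i v := by
  have h1 := branchScale_pos hm i
  unfold branchInv
  gcongr

lemma branchInv_contract (hm : 2 ≤ m) (i : ℕ) {v w : ℝ} (hv : 1 ≤ v) (hvw : v ≤ w) :
    (branchInv m i v - branchInv m i w) / branchInv m i w ≤ (1 - 1 / m) * ((w - v) / v) := by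
  have h1 := branchScale_pos hm i
  have h2 := branchScale_le hm i
  have hw : 0 < w := by linarith
  have hv0 : 0 < v := by linarith
  have e : (branchInv m i v - branchInv m i w) / branchInv m i w =
      branchScale m i / (w + branchScale m i) * ((w - v) / v) := by
    unfold branchInv
    have : w + branchScale m i ≠ 0 := by linarith
    have : 1 + branchScale m i / w ≠ 0 := by positivity
    field_simp
    ring
  rw [e]
  have h3 : 0 ≤ (w - v) / v := div_nonneg (by linarith) hv0.le
  refine mul_le_mul_of_nonneg_right ?_ h3
  have : 1 - 1 / m = (m - 1) / m := by field_simp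
  rw [this, div_le_div_iff₀ (by linarith) (by linarith)]
  nlinarith

lemma branchInv_dist_le (hm : 2 ≤ m) (i : ℕ) {v w : ℝ} (hv : 1 ≤ v) (hw : 1 ≤ w) :
    (branchInv m i v - branchInv m i w) / branchInv m i w ≤ branchScale m i := by
  have h1 := branchScale_pos hm i
  have hw' := (branchInv_mem hm i hw).1
  rw [div_le_iff₀ (by linarith)]
  have h3 : branchScale m i / v ≤ branchScale m i := div_le_self h1.le hv
  have : branchInv m i v = 1 + branchScale m i / v := rfl
  nlinarith

lemma abs_branchProb_sub_le (hm : 2 ≤ m) (i : ℕ) {v w : ℝ} (hv : 1 ≤ v) (hvw : v ≤ w) :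
    |branchProb m i v - branchProb m i w| ≤
      branchScale m (i + 1) * (2 * m * ((w - v) / v)) := by
  have h1 := branchScale_pos hm i
  have h2 := branchScale_pos hm (i + 1)
  have h1' := branchScale_le hm i
  have h2' := branchScale_succ_le_one hm i
  unfold branchProb
  set a := branchScale m (i + 1)
  set c := branchScale m i
  have hB := branchFactor_le hm i hv
  have hB0 : 0 ≤ (v + (m - 1)) / (v + c) := div_nonneg (by linarith) (by linarith)
  have hA : w / (w + a) ≤ 1 := by rw [div_le_one (by linarith)]; linarith
  have hA0 : 0 ≤ w / (w + a) := div_nonneg (by linarith) (by linarith)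
  have hr : 0 ≤ (w - v) / v := div_nonneg (by linarith) (by linarith)
  have dA : |v / (v + a) - w / (w + a)| ≤ (w - v) / v := by
    have : v / (v + a) - w / (w + a) = -(a * (w - v) / ((v + a) * (w + a))) := by
      have : v + a ≠ 0 := by linarith
      have : w + a ≠ 0 := by linarith
      field_simp
      ring
    rw [this, abs_neg, abs_of_nonneg (div_nonneg (mul_nonneg h2.le (by linarith)) (by nlinarith)),
      div_le_div_iff₀ (by nlinarith) (by linarith)]
    have : a * v ≤ (v + a) * (w + a) := by nlinarith
    nlinarith
  have dB : |(v + (m - 1)) / (v + c) - (w + (m - 1)) / (w + c)| ≤ m * ((w - v) / v) := by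
    have : (v + (m - 1)) / (v + c) - (w + (m - 1)) / (w + c) =
        (m - 1 - c) * (w - v) / ((v + c) * (w + c)) := by
      have : v + c ≠ 0 := by linarith
      have : w + c ≠ 0 := by linarith
      field_simp
      ring
    rw [this, abs_of_nonneg (div_nonneg (mul_nonneg (by linarith) (by linarith)) (by nlinarith)),
      ← mul_div_assoc, div_le_div_iff₀ (by nlinarith) (by linarith)]
    have h3 : v ≤ (v + c) * (w + c) := by nlinarith
    have h4 : (m - 1 - c) * v ≤ m * ((v + c) * (w + c)) :=
      mul_le_mul (by linarith) h3 (by linarith) (by linarith)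
    nlinarith
  rw [← sub_mul, abs_mul, abs_of_pos h2, mul_comm]
  refine mul_le_mul_of_nonneg_left ?_ h2.le
  have e : v / (v + a) * ((v + (m - 1)) / (v + c)) - w / (w + a) * ((w + (m - 1)) / (w + c)) =
      (v / (v + a) - w / (w + a)) * ((v + (m - 1)) / (v + c)) +
        w / (w + a) * ((v + (m - 1)) / (v + c) - (w + (m - 1)) / (w + c)) := by ring
  rw [e]
  refine (abs_add_le _ _).trans ?_
  rw [abs_mul, abs_mul, abs_of_nonneg hB0, abs_of_nonneg hA0]
  have t1 := mul_le_mul dA hB hB0 hr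
  have t2 := mul_le_mul hA dB (abs_nonneg _) zero_le_one
  linarith

end Branches

/-- `g` oscillates by at most `N` on `[1, m]` and is Lipschitz there with constant `4 m² N`
with respect to relative displacement. -/
def RegularBound (m : ℝ) (g : ℝ → ℝ) (N : ℝ) : Prop :=
  (∃ c, ∀ w ∈ Icc 1 m, g w ∈ Icc c (c + N)) ∧
    ∀ v ∈ Icc 1 m, ∀ w ∈ Icc 1 m, v ≤ w → |g v - g w| ≤ 4 * m ^ 2 * N * ((w - v) / v)

section Contraction

variable {m : ℝ} {g : ℝ → ℝ} {N : ℝ}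

lemma RegularBound.nonneg (hm : 2 ≤ m) (h : RegularBound m g N) : 0 ≤ N := by
  obtain ⟨⟨c, hc⟩, -⟩ := h
  have := hc 1 ⟨le_rfl, by linarith⟩
  linarith [this.1, this.2]

lemma RegularBound.continuousOn (hm : 2 ≤ m) (h : RegularBound m g N) :
    ContinuousOn g (Icc 1 m) := by
  have hN := h.nonneg hm
  refine (LipschitzOnWith.of_dist_le_mul (K := ⟨4 * m ^ 2 * N, by positivity⟩) ?_).continuousOn
  have key : ∀ v ∈ Icc 1 m, ∀ w ∈ Icc 1 m, v ≤ w →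
      |g v - g w| ≤ 4 * m ^ 2 * N * |v - w| := by
    intro v hv w hw hvw
    refine (h.2 v hv w hw hvw).trans ?_
    rw [abs_sub_comm, abs_of_nonneg (sub_nonneg.2 hvw)]
    gcongr
    exact div_le_self (by linarith) hv.1
  intro v hv w hw
  simp only [Real.dist_eq]
  rcases le_total v w with hvw | hvw
  · exact key v hv w hw hvw
  · rw [abs_sub_comm, abs_sub_comm v]
    exact key w hw v hv hvw

lemma RegularBound.summable (hm : 2 ≤ m) (h : RegularBound m g N) {w : ℝ} (hw : 1 ≤ w) :
    Summable (fun i => branchProb m i w * g (branchInv m i w)) := by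
  obtain ⟨⟨c, hc⟩, -⟩ := h
  refine Summable.of_norm_bounded ((hasSum_branchProb hm hw).summable.mul_left (|c| + |c + N|)) ?_
  intro i
  have hp := branchProb_nonneg hm i hw
  have hg := hc _ (branchInv_mem hm i hw)
  rw [norm_mul, Real.norm_of_nonneg hp, mul_comm]
  refine mul_le_mul_of_nonneg_right ?_ hp
  rw [Real.norm_eq_abs, abs_le]
  constructor
  · linarith [hg.1, neg_abs_le c, abs_nonneg (c + N)]
  · linarith [hg.2, le_abs_self (c + N), abs_nonneg c]

lemma RegularBound.dist_branchInv_le (hm : 2 ≤ m) (h : RegularBound m g N) (i : ℕ) {v w : ℝ}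
    (hv : 1 ≤ v) (hw : 1 ≤ w) :
    |g (branchInv m i v) - g (branchInv m i w)| ≤ 4 * m ^ 2 * N * branchScale m i := by
  have hN := h.nonneg hm
  rcases le_total v w with hvw | hvw
  · rw [abs_sub_comm]
    refine (h.2 _ (branchInv_mem hm i hw) _ (branchInv_mem hm i hv)
      (branchInv_anti hm i hv hvw)).trans ?_
    gcongr
    exact branchInv_dist_le hm i hv hw
  · refine (h.2 _ (branchInv_mem hm i hv) _ (branchInv_mem hm i hw)
      (branchInv_anti hm i hw hvw)).trans ?_
    gcongr
    exact branchInv_dist_le hm i hw hv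

lemma chanTransfer_sub_le (hm : 2 ≤ m) (h : RegularBound m g N) {v w : ℝ}
    (hv : v ∈ Icc 1 m) (hw : w ∈ Icc 1 m) :
    chanTransfer m g v - chanTransfer m g w ≤ (1 - branchScale m 7 / 4) * N := by
  have hN := h.nonneg hm
  have hs7 := branchScale_pos hm 7
  set α := branchScale m 7 / 2 with hα
  have hsv := h.summable hm hv.1
  have hsw := h.summable hm hw.1
  obtain ⟨c, hc⟩ := h.1
  have hsmall : 4 * m ^ 2 * N * branchScale m 6 ≤ N / 2 := by
    have h6 : 4 * m ^ 2 * branchScale m 6 ≤ 1 / 2 := by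
      unfold branchScale
      have hm0 : 0 < m := by linarith
      have : 4 * m ^ 2 * ((m - 1) / m ^ 6) = 4 * (m - 1) / m ^ 4 := by field_simp
      rw [this, div_le_div_iff₀ (by positivity) (by norm_num)]
      have : 8 ≤ m ^ 3 := by
        calc (8 : ℝ) = 2 ^ 3 := by norm_num
          _ ≤ m ^ 3 := by gcongr
      nlinarith
    nlinarith
  have hd := (abs_le.1 ((h.dist_branchInv_le hm 6 hv.1 hw.1).trans hsmall)).2
  -- the mass `α` of branch `6` is split off from both averages
  have up : chanTransfer m g v ≤ α * g (branchInv m 6 v) + (1 - α) * (c + N) := by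
    have h1 : chanTransfer m g v - (c + N) * 1 =
        ∑' i, branchProb m i v * (g (branchInv m i v) - (c + N)) := by
      rw [← (hasSum_branchProb hm hv.1).tsum_eq, ← tsum_mul_left]
      rw [chanTransfer, ← hsv.tsum_sub ((hasSum_branchProb hm hv.1).summable.mul_left _)]
      exact tsum_congr fun i => by ring
    have hsum : Summable fun i => branchProb m i v * (g (branchInv m i v) - (c + N)) := by
      refine (hsv.sub ((hasSum_branchProb hm hv.1).summable.mul_left (c + N))).congr ?_
      exact fun i => by ring
    have hg := fun i => (hc _ (branchInv_mem hm i hv.1)).2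
    have h2 := hsum.neg.le_tsum 6 fun j _ => by
      have := hg j
      have := branchProb_nonneg hm j hv.1
      simp only [← mul_neg]
      exact mul_nonneg (by assumption) (by linarith)
    rw [tsum_neg] at h2
    have h3 : α ≤ branchProb m 6 v := le_branchProb hm 6 hv.1
    have := hg 6
    nlinarith
  have lo : α * g (branchInv m 6 w) + (1 - α) * c ≤ chanTransfer m g w := by
    have h1 : chanTransfer m g w - c * 1 =
        ∑' i, branchProb m i w * (g (branchInv m i w) - c) := by
      rw [← (hasSum_branchProb hm hw.1).tsum_eq, ← tsum_mul_left]
      rw [chanTransfer, ← hsw.tsum_sub ((hasSum_branchProb hm hw.1).summable.mul_left _)]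
      exact tsum_congr fun i => by ring
    have hsum : Summable fun i => branchProb m i w * (g (branchInv m i w) - c) := by
      refine (hsw.sub ((hasSum_branchProb hm hw.1).summable.mul_left c)).congr ?_
      exact fun i => by ring
    have hg := fun i => (hc _ (branchInv_mem hm i hw.1)).1
    have h2 := hsum.le_tsum 6 fun j _ =>
      mul_nonneg (branchProb_nonneg hm j hw.1) (by linarith [hg j])
    have h3 : α ≤ branchProb m 6 w := le_branchProb hm 6 hw.1
    have := hg 6
    nlinarith
  have hα0 : 0 < α := by positivity
  have : branchScale m 7 / 4 = α / 2 := by rw [hα]; ring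
  rw [this]
  nlinarith

lemma abs_chanTransfer_sub_le (hm : 2 ≤ m) (h : RegularBound m g N) {v w : ℝ}
    (hv : v ∈ Icc 1 m) (hw : w ∈ Icc 1 m) (hvw : v ≤ w) :
    |chanTransfer m g v - chanTransfer m g w| ≤
      ((1 - 1 / m) * (4 * m ^ 2 * N) + 2 * m * N) * ((w - v) / v) := by
  have hN := h.nonneg hm
  have hsv := h.summable hm hv.1
  have hsw := h.summable hm hw.1
  have hpv := hasSum_branchProb hm hv.1
  have hpw := hasSum_branchProb hm hw.1
  obtain ⟨c, hc⟩ := h.1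
  have e : chanTransfer m g v - chanTransfer m g w =
      ∑' i, (branchProb m i v * (g (branchInv m i v) - g (branchInv m i w)) +
        (branchProb m i v - branchProb m i w) * (g (branchInv m i w) - c)) := by
    have h1 : chanTransfer m g v - c * 1 - (chanTransfer m g w - c * 1) =
      chanTransfer m g v - chanTransfer m g w := by ring
    rw [← h1]
    nth_rewrite 1 [← hpv.tsum_eq]
    rw [← hpw.tsum_eq, ← tsum_mul_left, ← tsum_mul_left, chanTransfer, chanTransfer,
      ← hsv.tsum_sub (hpv.summable.mul_left c), ← hsw.tsum_sub (hpw.summable.mul_left c),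
      ← (hsv.sub (hpv.summable.mul_left c)).tsum_sub (hsw.sub (hpw.summable.mul_left c))]
    exact tsum_congr fun i => by ring
  have hr : 0 ≤ (w - v) / v := div_nonneg (by linarith) (by linarith [hv.1])
  have hbd := (hpv.mul_right (4 * m ^ 2 * N * ((1 - 1 / m) * ((w - v) / v)))).add
    ((hasSum_branchScale_succ hm).mul_right (2 * m * ((w - v) / v) * N))
  rw [e, ← Real.norm_eq_abs]
  refine (tsum_of_norm_bounded hbd fun i => ?_).trans (le_of_eq (by ring))
  have hp := branchProb_nonneg hm i hv.1
  have hg := hc _ (branchInv_mem hm i hw.1)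
  refine (norm_add_le _ _).trans (add_le_add ?_ ?_)
  · rw [norm_mul, Real.norm_of_nonneg hp, Real.norm_eq_abs, abs_sub_comm]
    refine mul_le_mul_of_nonneg_left ((h.2 _ (branchInv_mem hm i hw.1) _ (branchInv_mem hm i hv.1)
      (branchInv_anti hm i hv.1 hvw)).trans ?_) hp
    gcongr
    exact branchInv_contract hm i hv.1 hvw
  · rw [norm_mul, Real.norm_eq_abs, Real.norm_eq_abs, ← mul_assoc]
    have h1 := abs_branchProb_sub_le hm i hv.1 hvw
    have h2 : |g (branchInv m i w) - c| ≤ N := by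
      rw [abs_of_nonneg (by linarith [hg.1])]; linarith [hg.2]
    exact mul_le_mul h1 h2 (abs_nonneg _) ((abs_nonneg _).trans h1)

lemma branchScale_seven_le (hm : 2 ≤ m) : branchScale m 7 ≤ 1 / m := by
  have hm0 : 0 < m := by linarith
  unfold branchScale
  rw [div_le_div_iff₀ (by positivity) hm0]
  have : m ^ 2 ≤ m ^ 7 := pow_le_pow_right₀ (by linarith) (by norm_num)
  nlinarith

lemma RegularBound.chanTransfer (hm : 2 ≤ m) (h : RegularBound m g N) :
    RegularBound m (chanTransfer m g) ((1 - branchScale m 7 / 4) * N) := by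
  have hN := h.nonneg hm
  constructor
  · have key : ∀ v ∈ Icc 1 m, ∀ w ∈ Icc 1 m,
        _root_.chanTransfer m g v - (1 - branchScale m 7 / 4) * N ≤ _root_.chanTransfer m g w :=
      fun v hv w hw => by linarith [chanTransfer_sub_le hm h hv hw]
    have h1 : (1 : ℝ) ∈ Icc 1 m := ⟨le_rfl, by linarith⟩
    refine ⟨sInf (_root_.chanTransfer m g '' Icc 1 m), fun w hw => ⟨?_, ?_⟩⟩
    · refine csInf_le ⟨_root_.chanTransfer m g 1 - (1 - branchScale m 7 / 4) * N, ?_⟩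
        ⟨w, hw, rfl⟩
      rintro _ ⟨u, hu, rfl⟩
      exact key 1 h1 u hu
    · rw [← sub_le_iff_le_add]
      refine le_csInf ⟨_, 1, h1, rfl⟩ ?_
      rintro _ ⟨u, hu, rfl⟩
      exact key w hw u hu
  · intro v hv w hw hvw
    refine (abs_chanTransfer_sub_le hm h hv hw hvw).trans ?_
    have hr : 0 ≤ (w - v) / v := div_nonneg (by linarith) (by linarith [hv.1])
    refine mul_le_mul_of_nonneg_right ?_ hr
    have hs := branchScale_seven_le hm
    have hm0 : 0 < m := by linarith
    have h2 : (1 - 1 / m) * (4 * m ^ 2 * N) + 2 * m * N = 4 * m ^ 2 * N - 2 * m * N := by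
      field_simp
      ring
    have h3 : branchScale m 7 * m ≤ 1 := by rwa [le_div_iff₀ hm0] at hs
    rw [h2]
    nlinarith [mul_nonneg hm0.le hN]

lemma RegularBound.iterate (hm : 2 ≤ m) (h : RegularBound m g N) (n : ℕ) :
    RegularBound m ((_root_.chanTransfer m)^[n] g) ((1 - branchScale m 7 / 4) ^ n * N) := by
  induction n with
  | zero => simpa using h
  | succ n ih =>
    rw [Function.iterate_succ_apply', pow_succ', mul_assoc]
    exact ih.chanTransfer hm

end Contraction

/-- The (unnormalized) invariant density of the Chan map in the coordinate `w = 1 + (m - 1) x`. -/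
noncomputable def chanWeight (m w : ℝ) : ℝ := 1 / (w * (w + (m - 1)))

section Density

variable {m : ℝ} {g : ℝ → ℝ} {N : ℝ}

lemma chanWeight_nonneg (hm : 2 ≤ m) {w : ℝ} (hw : 1 ≤ w) : 0 ≤ chanWeight m w := by
  unfold chanWeight
  have : 0 < m - 1 := by linarith
  positivity

lemma chanWeight_le_one (hm : 2 ≤ m) {w : ℝ} (hw : 1 ≤ w) : chanWeight m w ≤ 1 := by
  unfold chanWeight
  rw [div_le_one (by nlinarith)]
  nlinarith

lemma continuousOn_chanWeight (hm : 2 ≤ m) : ContinuousOn (chanWeight m) (Icc 1 m) := by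
  unfold chanWeight
  refine continuousOn_const.div (by fun_prop) fun w hw => ?_
  have := hw.1
  have : 0 < w * (w + (m - 1)) := mul_pos (by linarith) (by linarith)
  exact this.ne'

lemma continuousOn_branchInv (i : ℕ) : ContinuousOn (branchInv m i) (Icc 1 m) := by
  unfold branchInv
  refine continuousOn_const.add (continuousOn_const.div continuousOn_id fun w hw => ?_)
  have : 0 < w := by linarith [hw.1]
  exact this.ne'

lemma continuousOn_branchProb (hm : 2 ≤ m) (i : ℕ) :
    ContinuousOn (branchProb m i) (Icc 1 m) := by
  unfold branchProb
  have h := branchScale_pos hm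
  refine ((continuousOn_id.div (by fun_prop) fun w hw => ?_).mul
    (ContinuousOn.div (by fun_prop) (by fun_prop) fun w hw => ?_)).mul continuousOn_const
  · have : 0 < w + branchScale m (i + 1) := by linarith [hw.1, h (i + 1)]
    exact this.ne'
  · have : 0 < w + branchScale m i := by linarith [hw.1, h i]
    exact this.ne'

lemma integral_branch (hm : 2 ≤ m) (hg : ContinuousOn g (Icc 1 m)) (i : ℕ) {w : ℝ}
    (hw : w ∈ Icc 1 m) :
    ∫ t in (1 : ℝ)..w, branchProb m i t * g (branchInv m i t) * chanWeight m t =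
      ∫ u in (branchInv m i w)..(branchInv m i 1), g u * chanWeight m u := by
  have hsub : Icc 1 w ⊆ Icc 1 m := Icc_subset_Icc_right hw.2
  have hder : ∀ t ∈ Ioo (min 1 w) (max 1 w),
      HasDerivWithinAt (branchInv m i) (-branchScale m i / t ^ 2) (Ioi t) t := by
    intro t ht
    rw [min_eq_left hw.1] at ht
    have ht0 : t ≠ 0 := by linarith [ht.1]
    have h := ((hasDerivAt_const t (branchScale m i)).div (hasDerivAt_id t) ht0).const_add 1
    refine (h.congr_deriv ?_).hasDerivWithinAt
    simp
  have hcomp := intervalIntegral.integral_comp_mul_deriv'' (a := 1) (b := w)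
    (f := branchInv m i) (f' := fun t => -branchScale m i / t ^ 2)
    (g := fun u => g u * chanWeight m u)
    (by rw [uIcc_of_le hw.1]; exact (continuousOn_branchInv i).mono hsub) hder
    (by
      rw [uIcc_of_le hw.1]
      refine continuousOn_const.div (by fun_prop) fun t ht => ?_
      have : 0 < t := by linarith [ht.1]
      positivity)
    (by
      rw [uIcc_of_le hw.1]
      refine (hg.mul (continuousOn_chanWeight hm)).mono ?_
      rintro _ ⟨t, ht, rfl⟩
      exact branchInv_mem hm i ht.1)
  rw [intervalIntegral.integral_symm (branchInv m i 1), ← hcomp, ← intervalIntegral.integral_neg]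
  refine intervalIntegral.integral_congr fun t ht => ?_
  rw [uIcc_of_le hw.1] at ht
  have ht0 : 0 < t := by linarith [ht.1]
  have h1 := branchScale_pos hm (i + 1)
  have h2 : 0 < m - 1 := by linarith
  have h3 : 0 < m := by linarith
  simp only [Function.comp, branchProb, chanWeight, branchInv]
  rw [← mul_branchScale_succ hm i]
  generalize branchScale m (i + 1) = a at *
  generalize g (1 + m * a / t) = y
  have h5 : 1 + m * a / t = (t + m * a) / t := by field_simp
  have h6 : (t + m * a) / t + (m - 1) = m * (t + a) / t := by field_simp; ring
  rw [h5, h6]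
  have : t + a ≠ 0 := by positivity
  have : t + m * a ≠ 0 := by positivity
  have : t + (m - 1) ≠ 0 := by positivity
  field_simp

lemma hasSum_integral_branch (hm : 2 ≤ m) (h : RegularBound m g N) {w : ℝ} (hw : w ∈ Icc 1 m) :
    HasSum (fun i => ∫ u in (branchInv m i w)..(branchInv m i 1), g u * chanWeight m u)
      (∫ t in (1 : ℝ)..w, chanTransfer m g t * chanWeight m t) := by
  have hg := h.continuousOn hm
  obtain ⟨M, hM⟩ := isCompact_Icc.exists_bound_of_continuousOn hg
  have hsub : Icc 1 w ⊆ Icc 1 m := Icc_subset_Icc_right hw.2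
  have hmem : ∀ t ∈ uIoc 1 w, t ∈ Icc 1 m := fun t ht =>
    hsub (Ioc_subset_Icc_self (by rwa [uIoc_of_le hw.1] at ht))
  simp_rw [← integral_branch hm hg _ hw]
  refine intervalIntegral.hasSum_integral_of_dominated_convergence
    (fun i _ => m * branchScale m (i + 1) * M) ?_ ?_ ?_ ?_ ?_
  · intro i
    refine ContinuousOn.aestronglyMeasurable ?_ measurableSet_uIoc
    refine ContinuousOn.mono ?_ hmem
    refine ((continuousOn_branchProb hm i).mul (hg.comp (continuousOn_branchInv i) ?_)).mul
      (continuousOn_chanWeight hm)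
    exact fun t ht => branchInv_mem hm i ht.1
  · refine fun i => Filter.Eventually.of_forall fun t ht => ?_
    have ht1 := (hmem t ht).1
    rw [norm_mul, norm_mul, Real.norm_of_nonneg (branchProb_nonneg hm i ht1),
      Real.norm_of_nonneg (chanWeight_nonneg hm ht1)]
    have h1 := branchProb_le hm i ht1
    have h2 := hM _ (branchInv_mem hm i ht1)
    have h3 := chanWeight_le_one hm ht1
    have h4 := branchProb_nonneg hm i ht1
    calc _ ≤ m * branchScale m (i + 1) * M * 1 := by
          refine mul_le_mul (mul_le_mul h1 h2 (norm_nonneg _) (h4.trans h1)) h3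
            (chanWeight_nonneg hm ht1) ?_
          exact mul_nonneg (h4.trans h1) ((norm_nonneg _).trans h2)
      _ = _ := mul_one _
  · exact Filter.Eventually.of_forall fun t _ =>
      ((hasSum_branchScale_succ hm).summable.mul_left m).mul_right M
  · exact intervalIntegrable_const
  · exact Filter.Eventually.of_forall fun t ht =>
      (h.summable hm (hmem t ht).1).hasSum.mul_right _

lemma integral_chanWeight (hm : 2 ≤ m) {w : ℝ} (hw : w ∈ Icc 1 m) :
    ∫ t in (1 : ℝ)..w, chanWeight m t = Real.log (m * w / (w + (m - 1))) / (m - 1) := by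
  have hb : 0 < m - 1 := by linarith
  have key : ∀ t ∈ uIcc 1 w, HasDerivAt
      (fun t => (Real.log t - Real.log (t + (m - 1))) / (m - 1)) (chanWeight m t) t := by
    intro t ht
    rw [uIcc_of_le hw.1] at ht
    have ht0 : 0 < t := by linarith [ht.1]
    have h := ((Real.hasDerivAt_log ht0.ne').sub
      (((hasDerivAt_id t).add_const (m - 1)).log (by simp only [id]; positivity))).div_const (m - 1)
    refine h.congr_deriv ?_
    simp only [id, chanWeight]
    field_simp
    ring
  rw [intervalIntegral.integral_eq_sub_of_hasDerivAt key]
  · have hw0 : 0 < w := by linarith [hw.1]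
    rw [Real.log_div (by positivity) (by positivity), Real.log_mul (by positivity) hw0.ne',
      Real.log_one, show 1 + (m - 1) = m by ring]
    ring
  · refine ContinuousOn.intervalIntegrable ?_
    rw [uIcc_of_le hw.1]
    exact (continuousOn_chanWeight hm).mono (Icc_subset_Icc_right hw.2)

lemma abs_integral_sub_le (hm : 2 ≤ m) (h : RegularBound m g N)
    (hone : ∫ t in (1 : ℝ)..m, g t * chanWeight m t = 1) {w : ℝ} (hw : w ∈ Icc 1 m) :
    |(∫ t in (1 : ℝ)..w, g t * chanWeight m t) -
      (∫ t in (1 : ℝ)..w, chanWeight m t) / ∫ t in (1 : ℝ)..m, chanWeight m t| ≤ N * (m - 1) := by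
  have hN := h.nonneg hm
  have h1m : (1 : ℝ) ≤ m := by linarith
  have hg := h.continuousOn hm
  have hwt := continuousOn_chanWeight hm
  have hi : ∀ (f : ℝ → ℝ), ContinuousOn f (Icc 1 m) → ∀ u ∈ Icc 1 m,
      IntervalIntegrable f volume 1 u := by
    intro f hf u hu
    refine ContinuousOn.intervalIntegrable ?_
    rw [uIcc_of_le hu.1]
    exact hf.mono (Icc_subset_Icc_right hu.2)
  have hmm : m ∈ Icc 1 m := ⟨h1m, le_rfl⟩
  obtain ⟨c, hc⟩ := h.1
  set R := ∫ t in (1 : ℝ)..m, chanWeight m t with hR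
  have hR0 : 0 < R := by
    rw [hR, integral_chanWeight hm hmm]
    refine div_pos (Real.log_pos ?_) (by linarith)
    rw [one_lt_div (by linarith)]
    nlinarith
  have hlo : c * R ≤ 1 := by
    rw [← hone, hR, ← intervalIntegral.integral_const_mul]
    refine intervalIntegral.integral_mono_on h1m (hi _ (continuousOn_const.mul hwt) m hmm)
      (hi _ (hg.mul hwt) m hmm) fun t ht => ?_
    exact mul_le_mul_of_nonneg_right (hc t ht).1 (chanWeight_nonneg hm ht.1)
  have hhi : 1 ≤ (c + N) * R := by
    rw [← hone, hR, ← intervalIntegral.integral_const_mul]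
    refine intervalIntegral.integral_mono_on h1m (hi _ (hg.mul hwt) m hmm)
      (hi _ (continuousOn_const.mul hwt) m hmm) fun t ht => ?_
    exact mul_le_mul_of_nonneg_right (hc t ht).2 (chanWeight_nonneg hm ht.1)
  have hk1 : c ≤ 1 / R := by rwa [le_div_iff₀ hR0]
  have hk2 : 1 / R ≤ c + N := by rwa [div_le_iff₀ hR0]
  rw [div_eq_mul_one_div, mul_comm _ (1 / R), ← intervalIntegral.integral_const_mul,
    ← intervalIntegral.integral_sub (hi (fun t => g t * chanWeight m t) (hg.mul hwt) w hw)
      (hi (fun t => 1 / R * chanWeight m t) (continuousOn_const.mul hwt) w hw), ← Real.norm_eq_abs]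
  refine (intervalIntegral.norm_integral_le_of_norm_le_const (C := N) fun t ht => ?_).trans ?_
  · rw [uIoc_of_le hw.1] at ht
    have ht' : t ∈ Icc 1 m := ⟨ht.1.le, ht.2.trans hw.2⟩
    rw [← sub_mul, norm_mul, Real.norm_of_nonneg (chanWeight_nonneg hm ht'.1), Real.norm_eq_abs]
    have h1 : |g t - 1 / R| ≤ N := by
      have := hc t ht'
      rw [abs_le]
      constructor <;> linarith [this.1, this.2]
    calc _ ≤ N * 1 := mul_le_mul h1 (chanWeight_le_one hm ht'.1) (chanWeight_nonneg hm ht'.1) hN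
      _ = N := mul_one N
  · rw [abs_of_nonneg (by linarith [hw.1])]
    gcongr
    exact hw.2

lemma exists_regularBound (hm : 2 ≤ m) (hg : ContDiffOn ℝ 1 g (Icc 1 m)) :
    ∃ N, RegularBound m g N := by
  obtain ⟨M, hM⟩ := isCompact_Icc.exists_bound_of_continuousOn hg.continuousOn
  obtain ⟨K, hK⟩ := hg.exists_lipschitzOnWith one_ne_zero (convex_Icc 1 m) isCompact_Icc
  have hM0 : 0 ≤ M := (norm_nonneg _).trans (hM 1 ⟨le_rfl, by linarith⟩)
  refine ⟨2 * M + K, ⟨-M, fun w hw => ?_⟩, fun v hv w hw hvw => ?_⟩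
  · have := abs_le.1 (hM w hw)
    exact ⟨this.1, by linarith [this.2, K.coe_nonneg]⟩
  · have h1 := hK.dist_le_mul v hv w hw
    rw [Real.dist_eq, Real.dist_eq, abs_sub_comm v, abs_of_nonneg (sub_nonneg.2 hvw)] at h1
    refine h1.trans ?_
    have hv0 : 0 < v := by linarith [hv.1]
    have h2 : w - v = v * ((w - v) / v) := by field_simp
    have hr : 0 ≤ (w - v) / v := div_nonneg (by linarith) hv0.le
    calc (K : ℝ) * (w - v) = K * v * ((w - v) / v) := by rw [mul_assoc, ← h2]
      _ ≤ _ := ?_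
    refine mul_le_mul_of_nonneg_right ?_ hr
    have h3 : (K : ℝ) * v ≤ (2 * M + K) * m :=
      mul_le_mul (by linarith) hv.2 hv0.le (by linarith [K.coe_nonneg])
    have h4 : 0 ≤ (2 * M + K) := by linarith [K.coe_nonneg]
    nlinarith [mul_nonneg h4 (by linarith : 0 ≤ m), mul_nonneg h4 (by nlinarith : 0 ≤ 4 * m ^ 2 - m)]

end Density

section Measures

variable {m : ℕ}

lemma chanTau_of_mem (hm : 2 ≤ m) (i : ℕ) {s : ℝ}
    (hs : s ∈ Ioc ((m : ℝ)⁻¹ ^ (i + 1)) ((m : ℝ)⁻¹ ^ i)) :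
    chanTau m s = 1 / ((m : ℝ) - 1) * ((m : ℝ)⁻¹ ^ i / s - 1) := by
  have hm1 : (1 : ℝ) < m := by exact_mod_cast hm
  have hm0 : (0 : ℝ) < m := by linarith
  have hs0 : 0 < s := lt_trans (by positivity) hs.1
  have hlog : ∀ k : ℕ, Real.logb m ((m : ℝ)⁻¹ ^ k) = -k := by
    intro k
    rw [inv_pow, Real.logb_inv, Real.logb_pow, Real.logb_self_eq_one hm1, mul_one]
  have hfl : ⌊-Real.logb m s⌋ = (i : ℤ) := by
    rw [Int.floor_eq_iff]
    have h1 := Real.logb_lt_logb hm1 (by positivity) hs.1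
    have h2 := Real.logb_le_logb_of_le hm1 hs0 hs.2
    rw [hlog] at h1 h2
    push_cast at h1 ⊢
    constructor <;> linarith
  rw [chanTau, if_neg hs0.ne', hfl, zpow_natCast, inv_pow]
  field_simp

lemma measurable_chanTau (m : ℕ) : Measurable (chanTau m) := by
  unfold chanTau
  refine Measurable.ite (measurableSet_singleton 0) measurable_const ?_
  have h : Measurable fun x : ℝ => (m : ℝ) ^ ⌊-Real.logb m x⌋ :=
    (measurable_from_top (f := fun k : ℤ => (m : ℝ) ^ k)).comp
      (Int.measurable_floor.comp ((Real.measurable_log.div_const _).neg))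
  fun_prop

lemma exists_mem_Ioc_inv_pow (hm : 2 ≤ m) {s : ℝ} (hs : s ∈ Ioc (0 : ℝ) 1) :
    ∃ i : ℕ, s ∈ Ioc ((m : ℝ)⁻¹ ^ (i + 1)) ((m : ℝ)⁻¹ ^ i) := by
  have hm1 : (1 : ℝ) < m := by exact_mod_cast hm
  exact exists_nat_pow_near_of_lt_one hs.1 hs.2 (by positivity) (inv_lt_one_of_one_lt₀ hm1)

lemma chanTau_mem_Icc (hm : 2 ≤ m) {s : ℝ} (hs : s ∈ Icc (0 : ℝ) 1) :
    chanTau m s ∈ Icc (0 : ℝ) 1 := by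
  have hm1 : (1 : ℝ) < m := by exact_mod_cast hm
  rcases hs.1.eq_or_lt with h0 | h0
  · simp [chanTau, ← h0]
  obtain ⟨i, hi⟩ := exists_mem_Ioc_inv_pow hm ⟨h0, hs.2⟩
  rw [chanTau_of_mem hm i hi]
  have h1 : 1 ≤ (m : ℝ)⁻¹ ^ i / s := by rw [one_le_div h0]; exact hi.2
  have h2 : (m : ℝ)⁻¹ ^ i / s ≤ m := by
    rw [div_le_iff₀ h0]
    have := hi.1.le
    rw [pow_succ, mul_inv_le_iff₀ (by linarith)] at this
    linarith
  constructor
  · exact mul_nonneg (by rw [one_div_nonneg]; linarith) (by linarith)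
  · rw [one_div_mul_eq_div, div_le_one (by linarith)]
    linarith

lemma countable_chanTau_fiber (hm : 2 ≤ m) (y : ℝ) : (chanTau m ⁻¹' {y}).Countable := by
  have hm1 : (1 : ℝ) < m := by exact_mod_cast hm
  refine ((countable_range fun k : ℤ => 1 / ((m : ℝ) ^ k * (1 + (m - 1) * y))).insert 0).mono ?_
  intro s hs
  by_cases h0 : s = 0
  · exact Or.inl h0
  refine Or.inr ⟨⌊-Real.logb m s⌋, ?_⟩
  have hs' : chanTau m s = y := hs
  rw [chanTau, if_neg h0] at hs'
  have hk : (m : ℝ) ^ ⌊-Real.logb m s⌋ ≠ 0 := (zpow_pos (by linarith) _).ne'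
  have hm' : (m : ℝ) - 1 ≠ 0 := by linarith
  simp only [← hs']
  generalize (m : ℝ) ^ ⌊-Real.logb m s⌋ = k at hk
  have : 1 + ((m : ℝ) - 1) * (1 / (m - 1) * (1 / (k * s) - 1)) = 1 / (k * s) := by
    field_simp
    ring
  rw [this]
  field_simp

lemma nullSingletonClass_map_chanTau (hm : 2 ≤ m) (ν : Measure ℝ) [NullSingletonClass ν] :
    NullSingletonClass (ν.map (chanTau m)) := by
  refine ⟨fun y => ?_⟩
  rw [Measure.map_apply (measurable_chanTau m) (measurableSet_singleton y)]
  exact (countable_chanTau_fiber hm y).measure_zero ν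

lemma map_chanTau_compl_Icc (hm : 2 ≤ m) {ν : Measure ℝ} (hν : ν (Icc (0 : ℝ) 1)ᶜ = 0) :
    ν.map (chanTau m) (Icc (0 : ℝ) 1)ᶜ = 0 := by
  rw [Measure.map_apply (measurable_chanTau m) measurableSet_Icc.compl]
  exact measure_mono_null (fun s hs hs' => hs (chanTau_mem_Icc hm hs')) hν

lemma chanTau_preimage_Iic_ae_eq (hm : 2 ≤ m) (ν : Measure ℝ) [NullSingletonClass ν]
    (hν : ν (Icc (0 : ℝ) 1)ᶜ = 0) {x : ℝ} (hx : x ∈ Icc (0 : ℝ) 1) :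
    chanTau m ⁻¹' Iic x =ᵐ[ν]
      ⋃ i : ℕ, Ioc ((m : ℝ)⁻¹ ^ i / (1 + (m - 1) * x)) ((m : ℝ)⁻¹ ^ i) := by
  have hm1 : (1 : ℝ) < m := by exact_mod_cast hm
  have hm0 : (0 : ℝ) < m - 1 := by linarith
  set w : ℝ := 1 + (m - 1) * x with hw
  have hw1 : 1 ≤ w := by nlinarith [hx.1]
  have hwm : w ≤ m := by nlinarith [hx.2]
  have hcount : ν (insert 0 (range fun i : ℕ => (m : ℝ)⁻¹ ^ i / w)) = 0 :=
    ((countable_range _).insert 0).measure_zero ν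
  have key : ∀ (i : ℕ) (s : ℝ), s ∈ Ioc ((m : ℝ)⁻¹ ^ (i + 1)) ((m : ℝ)⁻¹ ^ i) →
      (chanTau m s ≤ x ↔ (m : ℝ)⁻¹ ^ i / w ≤ s) := by
    intro i s hi
    have hs0 : 0 < s := lt_trans (by positivity) hi.1
    rw [chanTau_of_mem hm i hi, one_div_mul_eq_div, div_le_iff₀ hm0, sub_le_iff_le_add,
      div_le_iff₀ hs0, div_le_iff₀ (by linarith), hw]
    ring_nf
  refine Filter.eventuallyEq_set.2 ?_
  filter_upwards [compl_mem_ae_iff.2 hν, compl_mem_ae_iff.2 hcount] with s hs hs'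
  rw [compl_compl] at hs
  simp only [mem_compl_iff, mem_insert_iff, mem_range, not_or, not_exists] at hs'
  simp only [mem_preimage, mem_Iic, mem_iUnion]
  constructor
  · intro hsx
    obtain ⟨i, hi⟩ := exists_mem_Ioc_inv_pow hm ⟨lt_of_le_of_ne hs.1 (Ne.symm hs'.1), hs.2⟩
    exact ⟨i, lt_of_le_of_ne ((key i s hi).1 hsx) (hs'.2 i), hi.2⟩
  · rintro ⟨i, hi⟩
    refine (key i s ⟨lt_of_le_of_lt ?_ hi.1, hi.2⟩).2 hi.1.le
    rw [pow_succ, ← div_eq_mul_inv]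
    gcongr

lemma hasSum_measureReal_chanTau (hm : 2 ≤ m) (ν : Measure ℝ) [IsProbabilityMeasure ν]
    [NullSingletonClass ν] (hν : ν (Icc (0 : ℝ) 1)ᶜ = 0) {x : ℝ} (hx : x ∈ Icc (0 : ℝ) 1) :
    HasSum (fun i : ℕ => ν.real (Iic ((m : ℝ)⁻¹ ^ i)) -
        ν.real (Iic ((m : ℝ)⁻¹ ^ i / (1 + (m - 1) * x))))
      ((ν.map (chanTau m)).real (Iic x)) := by
  have hm1 : (1 : ℝ) < m := by exact_mod_cast hm
  have hw1 : (1 : ℝ) ≤ 1 + (m - 1) * x := by nlinarith [hx.1]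
  have hwm : 1 + (m - 1) * x ≤ (m : ℝ) := by nlinarith [hx.2]
  have hdisj : Pairwise (Function.onFun Disjoint fun i : ℕ =>
      Ioc ((m : ℝ)⁻¹ ^ i / (1 + (m - 1) * x)) ((m : ℝ)⁻¹ ^ i)) := by
    have hanti : Antitone fun i : ℕ => (m : ℝ)⁻¹ ^ i :=
      pow_right_anti₀ (by positivity) (inv_le_one_of_one_le₀ hm1.le)
    refine hanti.pairwise_disjoint_on_Ioc_succ.mono fun i j hij => hij.mono ?_ ?_
    all_goals
      refine Ioc_subset_Ioc_left ?_
      simp only [Order.succ_eq_add_one]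
      rw [pow_succ, ← div_eq_mul_inv]
      gcongr
  have hsum := measure_iUnion (μ := ν) hdisj fun i => measurableSet_Ioc
  have h := ENNReal.hasSum_toReal (hsum ▸ measure_ne_top ν _)
  rw [← ENNReal.tsum_toReal_eq fun i => measure_ne_top ν _, ← hsum,
    ← measure_congr (chanTau_preimage_Iic_ae_eq hm ν hν hx),
    ← Measure.map_apply (measurable_chanTau m) measurableSet_Iic] at h
  have e : (fun i : ℕ => ν.real (Iic ((m : ℝ)⁻¹ ^ i)) -
      ν.real (Iic ((m : ℝ)⁻¹ ^ i / (1 + (m - 1) * x)))) = fun i : ℕ =>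
      (ν (Ioc ((m : ℝ)⁻¹ ^ i / (1 + (m - 1) * x)) ((m : ℝ)⁻¹ ^ i))).toReal := by
    funext i
    have hle : (m : ℝ)⁻¹ ^ i / (1 + (m - 1) * x) ≤ (m : ℝ)⁻¹ ^ i :=
      div_le_self (by positivity) hw1
    rw [← Iic_sdiff_Iic, ← measureReal_def,
      measureReal_sdiff (Iic_subset_Iic.2 hle) measurableSet_Iic]
  rw [e]
  exact h

/-- `ν` has density `g` with respect to the unnormalized invariant measure, in the coordinate
`w = 1 + (m - 1) x`. -/
def HasChanDensity (m : ℕ) (ν : Measure ℝ) (g : ℝ → ℝ) : Prop :=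
  ∀ x ∈ Icc (0 : ℝ) 1,
    ν.real (Iic x) = ∫ t in (1 : ℝ)..(1 + (m - 1) * x), g t * chanWeight m t

lemma one_add_mul_mem (hm : 2 ≤ m) {x : ℝ} (hx : x ∈ Icc (0 : ℝ) 1) :
    1 + ((m : ℝ) - 1) * x ∈ Icc (1 : ℝ) m := by
  have hm1 : (1 : ℝ) < m := by exact_mod_cast hm
  constructor
  · nlinarith [hx.1]
  · nlinarith [hx.2]

lemma HasChanDensity.map (hm : 2 ≤ m) {ν : Measure ℝ} [IsProbabilityMeasure ν]
    [NullSingletonClass ν] (hν : ν (Icc (0 : ℝ) 1)ᶜ = 0) {g : ℝ → ℝ} {N : ℝ}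
    (hg : RegularBound m g N) (h : HasChanDensity m ν g) :
    HasChanDensity m (ν.map (chanTau m)) (chanTransfer m g) := by
  have hm2 : (2 : ℝ) ≤ m := by exact_mod_cast hm
  have hm0 : (0 : ℝ) < m := by linarith
  intro x hx
  have hw := one_add_mul_mem hm hx
  refine (hasSum_measureReal_chanTau hm ν hν hx).unique ?_
  have hsum := hasSum_integral_branch hm2 hg hw
  have hpow : ∀ i : ℕ, (m : ℝ)⁻¹ ^ i ∈ Icc (0 : ℝ) 1 := fun i =>
    ⟨by positivity, pow_le_one₀ (by positivity) (inv_le_one_of_one_le₀ (by linarith))⟩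
  have hint : ∀ u ∈ Icc (1 : ℝ) m,
      IntervalIntegrable (fun t => g t * chanWeight m t) volume 1 u := by
    intro u hu
    refine ContinuousOn.intervalIntegrable ?_
    rw [uIcc_of_le hu.1]
    exact ((hg.continuousOn hm2).mul (continuousOn_chanWeight hm2)).mono
      (Icc_subset_Icc_right hu.2)
  have e : (fun i : ℕ => ν.real (Iic ((m : ℝ)⁻¹ ^ i)) -
      ν.real (Iic ((m : ℝ)⁻¹ ^ i / (1 + (m - 1) * x)))) = fun i : ℕ =>
      ∫ u in (branchInv m i (1 + (m - 1) * x))..(branchInv m i 1), g u * chanWeight m u := by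
    funext i
    have hi := hpow i
    have hi' : (m : ℝ)⁻¹ ^ i / (1 + (m - 1) * x) ∈ Icc (0 : ℝ) 1 :=
      ⟨div_nonneg hi.1 (by linarith [hw.1]), (div_le_self hi.1 hw.1).trans hi.2⟩
    have e1 : 1 + ((m : ℝ) - 1) * (m : ℝ)⁻¹ ^ i = branchInv m i 1 := by
      rw [branchInv, branchScale, inv_pow, div_one, div_eq_mul_inv]
    have e2 : 1 + ((m : ℝ) - 1) * ((m : ℝ)⁻¹ ^ i / (1 + (m - 1) * x)) =
        branchInv m i (1 + (m - 1) * x) := by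
      rw [branchInv, branchScale, inv_pow, div_eq_mul_inv ((m : ℝ) - 1), mul_div_assoc]
    rw [h _ hi, h _ hi', e1, e2]
    exact intervalIntegral.integral_interval_sub_left (hint _ (branchInv_mem hm2 i le_rfl))
      (hint _ (branchInv_mem hm2 i hw.1))
  rw [e]
  exact hsum

lemma exists_hasChanDensity (hm : 2 ≤ m) {ν : Measure ℝ} (h0 : ν.real (Iic 0) = 0)
    (hν : ContDiffOn ℝ 2 (fun x => ν.real (Iic x)) (Icc (0 : ℝ) 1)) :
    ∃ g, ContDiffOn ℝ 1 g (Icc (1 : ℝ) m) ∧ HasChanDensity m ν g := by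
  have hm1 : (1 : ℝ) < m := by exact_mod_cast hm
  have hb : (0 : ℝ) < m - 1 := by linarith
  set f : ℝ → ℝ := fun x => ν.real (Iic x) with hf
  set φ : ℝ → ℝ := fun w => (w - 1) / (m - 1) with hφ
  have hφmem : MapsTo φ (Icc (1 : ℝ) m) (Icc 0 1) := by
    intro w hw
    refine ⟨div_nonneg (by linarith [hw.1]) hb.le, ?_⟩
    rw [hφ]
    simp only
    rw [div_le_one hb]
    linarith [hw.2]
  have hφs : ContDiff ℝ 1 φ := by fun_prop
  have hd : ContDiffOn ℝ 1 (derivWithin f (Icc 0 1)) (Icc (0 : ℝ) 1) :=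
    hν.derivWithin (uniqueDiffOn_Icc zero_lt_one) (by norm_num)
  have hdφ : ContDiffOn ℝ 1 (fun w => derivWithin f (Icc 0 1) (φ w)) (Icc (1 : ℝ) m) :=
    hd.comp hφs.contDiffOn hφmem
  refine ⟨fun w => derivWithin f (Icc 0 1) (φ w) / (m - 1) * (w * (w + (m - 1))), ?_, ?_⟩
  · exact (hdφ.div_const _).mul (by fun_prop)
  intro x hx
  have hw := one_add_mul_mem hm hx
  set w : ℝ := 1 + (m - 1) * x with hwdef
  have hsub : Icc 1 w ⊆ Icc (1 : ℝ) m := Icc_subset_Icc_right hw.2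
  have e : ∫ t in (1 : ℝ)..w, derivWithin f (Icc 0 1) (φ t) / (m - 1) * (t * (t + (m - 1))) *
      chanWeight m t = ∫ t in (1 : ℝ)..w, derivWithin f (Icc 0 1) (φ t) / (m - 1) := by
    refine intervalIntegral.integral_congr fun t ht => ?_
    rw [uIcc_of_le hw.1] at ht
    have h1 : 0 < t := by linarith [ht.1]
    have h2 : t + ((m : ℝ) - 1) ≠ 0 := by positivity
    simp only [chanWeight]
    field_simp
  have hftc : ∫ t in (1 : ℝ)..w, derivWithin f (Icc 0 1) (φ t) / (m - 1) = f (φ w) - f (φ 1) := by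
    refine intervalIntegral.integral_eq_sub_of_hasDerivAt_of_le (f := fun t => f (φ t)) hw.1
      ((hν.continuousOn.comp hφs.continuous.continuousOn hφmem).mono hsub) ?_ ?_
    · intro t ht
      have hφt : φ t ∈ Ioo (0 : ℝ) 1 := by
        refine ⟨div_pos (by linarith [ht.1]) hb, ?_⟩
        rw [hφ]
        simp only
        rw [div_lt_one hb]
        linarith [ht.2, hw.2]
      have hnhds := Icc_mem_nhds hφt.1 hφt.2
      have h1 : HasDerivAt f (derivWithin f (Icc 0 1) (φ t)) (φ t) :=
        ((hν.differentiableOn (by norm_num) (φ t)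
          (Ioo_subset_Icc_self hφt)).hasDerivWithinAt).hasDerivAt hnhds
      have h2 : HasDerivAt φ (1 / (m - 1)) t := ((hasDerivAt_id t).sub_const 1).div_const _
      refine (h1.comp t h2).congr_deriv ?_
      ring
    · refine ContinuousOn.intervalIntegrable ?_
      rw [uIcc_of_le hw.1]
      exact (hdφ.continuousOn.div_const _).mono hsub
  have e1 : φ w = x := by
    simp only [hφ, hwdef]
    field_simp
    ring
  have e2 : φ 1 = 0 := by simp [hφ]
  rw [e, hftc, e1, e2, hf]
  simp [h0]

lemma HasChanDensity.iterate (hm : 2 ≤ m) {μ : Measure ℝ} [IsProbabilityMeasure μ]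
    [NullSingletonClass μ] (hμ : μ (Icc (0 : ℝ) 1)ᶜ = 0) {g : ℝ → ℝ} {N : ℝ}
    (hg : RegularBound m g N) (h : HasChanDensity m μ g) (n : ℕ) :
    HasChanDensity m (μ.map (chanTau m)^[n]) ((chanTransfer m)^[n] g) ∧
      μ.map (chanTau m)^[n] (Icc (0 : ℝ) 1)ᶜ = 0 ∧
      NullSingletonClass (μ.map (chanTau m)^[n]) := by
  have hm2 : (2 : ℝ) ≤ m := by exact_mod_cast hm
  have hmeas := measurable_chanTau m
  induction n with
  | zero =>
    simp only [Function.iterate_zero, Measure.map_id]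
    exact ⟨h, hμ, inferInstance⟩
  | succ n ih =>
    obtain ⟨h1, h2, h3⟩ := ih
    have : IsProbabilityMeasure (μ.map (chanTau m)^[n]) :=
      Measure.isProbabilityMeasure_map (hmeas.iterate n).aemeasurable
    have e : μ.map (chanTau m)^[n + 1] = (μ.map (chanTau m)^[n]).map (chanTau m) := by
      rw [Measure.map_map hmeas (hmeas.iterate n), Function.iterate_succ']
    rw [e, Function.iterate_succ_apply']
    exact ⟨h1.map hm h2 (hg.iterate hm2 n), map_chanTau_compl_Icc hm h2,
      nullSingletonClass_map_chanTau hm _⟩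

lemma chanOmega_eq (hm : 2 ≤ m) {x : ℝ} (hx : x ∈ Icc (0 : ℝ) 1) :
    chanOmega m x = (∫ t in (1 : ℝ)..(1 + (m - 1) * x), chanWeight m t) /
      ∫ t in (1 : ℝ)..m, chanWeight m t := by
  have hm2 : (2 : ℝ) ≤ m := by exact_mod_cast hm
  have hb : (m : ℝ) - 1 ≠ 0 := by linarith
  rw [integral_chanWeight hm2 (one_add_mul_mem hm hx),
    integral_chanWeight hm2 ⟨by linarith, le_rfl⟩, chanOmega, chanK,
    div_div_div_cancel_right₀ hb, div_right_comm, div_self (pow_ne_zero 2 hb),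
    one_div_mul_eq_div]
  congr 2
  · congr 1 <;> ring
  · congr 1 <;> ring

end Measures

/-- Gauss–Kuzmin theorem: if `μ` is a non-atomic Borel probability measure
on `[0,1]` whose distribution function `F_0(x) = μ([0,x])` is twice continuously
differentiable on `[0,1]`, and `F_n(x) = μ{t : τ_mⁿ(t) ≤ x}`, then there are constants
`q ∈ (0,1)` and `C > 0` such that `|F_n(x) − ω_m(x)| ≤ C·qⁿ` for all `n` and `x ∈ [0,1]`. -/
theorem chan_gauss_kuzmin (m : ℕ) (hm : 2 ≤ m)
    (μ : MeasureTheory.Measure ℝ) [MeasureTheory.IsProbabilityMeasure μ]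
    (hsupp : μ (Set.Icc (0 : ℝ) 1)ᶜ = 0)
    (hatom : ∀ x : ℝ, μ {x} = 0)
    (F : ℕ → ℝ → ℝ)
    (hF : ∀ n : ℕ, ∀ x : ℝ,
      F n x = (μ {t | t ∈ Set.Icc (0 : ℝ) 1 ∧ (chanTau m)^[n] t ≤ x}).toReal)
    (hsmooth : ContDiffOn ℝ 2 (F 0) (Set.Icc (0 : ℝ) 1)) :
    ∃ q ∈ Set.Ioo (0 : ℝ) 1, ∃ C > (0 : ℝ), ∀ n : ℕ, ∀ x ∈ Set.Icc (0 : ℝ) 1,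
      |F n x - chanOmega m x| ≤ C * q ^ n := by
  have hm2 : (2 : ℝ) ≤ m := by exact_mod_cast hm
  have hmeas := measurable_chanTau m
  have : NullSingletonClass μ := ⟨hatom⟩
  have hFmap : ∀ n x, F n x = (μ.map (chanTau m)^[n]).real (Iic x) := by
    intro n x
    rw [hF, measureReal_def, Measure.map_apply (hmeas.iterate n) measurableSet_Iic]
    congr 1
    refine measure_congr (Filter.eventuallyEq_set.2 ?_)
    filter_upwards [compl_mem_ae_iff.2 hsupp] with t ht
    rw [compl_compl] at ht
    exact ⟨fun h => h.2, fun h => ⟨ht, h⟩⟩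
  have hF0 : F 0 = fun x => μ.real (Iic x) := by
    funext x
    rw [hFmap, Function.iterate_zero, Measure.map_id]
  have h0 : μ.real (Iic 0) = 0 := by
    have : μ (Iic (0 : ℝ)) ≤ 0 := by
      calc μ (Iic (0 : ℝ)) ≤ μ ((Icc (0 : ℝ) 1)ᶜ ∪ {0}) := by
            refine measure_mono fun s hs => ?_
            rcases (show s ≤ 0 from hs).eq_or_lt with h | h
            · exact Or.inr h
            · exact Or.inl fun h' => absurd h'.1 (not_le.2 h)
        _ ≤ μ (Icc (0 : ℝ) 1)ᶜ + μ {0} := measure_union_le _ _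
        _ = 0 := by rw [hsupp, hatom, add_zero]
    rw [measureReal_def, nonpos_iff_eq_zero.1 this, ENNReal.toReal_zero]
  obtain ⟨g, hgs, hgd⟩ := exists_hasChanDensity hm h0 (hF0 ▸ hsmooth)
  obtain ⟨N, hN⟩ := exists_regularBound hm2 hgs
  have hN0 := hN.nonneg hm2
  have hs := branchScale_pos hm2 7
  have hs1 := branchScale_succ_le_one hm2 6
  refine ⟨1 - branchScale m 7 / 4, ⟨by linarith, by linarith⟩, N * (m - 1) + 1,
    by nlinarith, fun n x hx => ?_⟩
  obtain ⟨hd, hsupp', -⟩ := hgd.iterate hm hsupp hN n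
  have hn := hN.iterate hm2 n
  have hone : ∫ t in (1 : ℝ)..m, (chanTransfer m)^[n] g t * chanWeight m t = 1 := by
    have : IsProbabilityMeasure (μ.map (chanTau m)^[n]) :=
      Measure.isProbabilityMeasure_map (hmeas.iterate n).aemeasurable
    have h1 := hd 1 ⟨zero_le_one, le_rfl⟩
    rw [mul_one, add_sub_cancel] at h1
    rw [← h1]
    have h2 : (μ.map (chanTau m)^[n]) (Iic 1)ᶜ = 0 :=
      measure_mono_null (compl_subset_compl.2 Icc_subset_Iic_self) hsupp'
    rw [measureReal_def, (prob_compl_eq_zero_iff measurableSet_Iic).1 h2, ENNReal.toReal_one]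
  rw [hFmap, hd x hx, chanOmega_eq hm hx]
  refine (abs_integral_sub_le hm2 hn hone (one_add_mul_mem hm hx)).trans ?_
  have hq : 0 ≤ (1 - branchScale m 7 / 4) ^ n := pow_nonneg (by linarith) n
  nlinarith
end

section
/- Let μ be a non-atomic Borel probability measure on [0,1] whose distribution function F_{m,0}(x) = μ([0,x]) is twice continuously differentiable on [0,1]. Then for every x ∈ [0,1], lim_{n→∞} μ({t : τ_mⁿ(t) ≤ x}) = γ_m([0,x]), where γ_m is the Borel measure on [0,1] with density ρ_m(x) = k_m/(((m−1)x+1)·((m−1)x+m)) and k_m = (m−1)²/log(m²/(2m−1)). -/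
open MeasureTheory Set

/-- The density `ρ_m(x) = k_m / (((m-1)x+1)((m-1)x+m))`. -/
noncomputable def chanRho (m : ℕ) (x : ℝ) : ℝ :=
  chanK m / ((((m : ℝ) - 1) * x + 1) * (((m : ℝ) - 1) * x + (m : ℝ)))

/-- The measure `γ_m` on `[0,1]` with density `ρ_m` w.r.t. Lebesgue measure. -/
noncomputable def chanGamma (m : ℕ) : MeasureTheory.Measure ℝ :=
  (MeasureTheory.volume.restrict (Set.Icc (0 : ℝ) 1)).withDensity
    fun x => ENNReal.ofReal (chanRho m x)

open Filter Topology

namespace Chan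

/-- The scale `(M - 1) / Mⁱ` of the `i`-th branch, in the coordinate `u = (M - 1) y + 1`. -/
noncomputable def scale (M : ℝ) (i : ℕ) : ℝ := (M - 1) / M ^ i

/-- The probability of the `i`-th inverse branch, as a function of `u = (M - 1) y + 1`. -/
noncomputable def weight (M : ℝ) (i : ℕ) (u : ℝ) : ℝ :=
  scale M i * u * (u + M - 1) / ((u + scale M i) * (M * u + scale M i))

/-- The transfer operator of `τ_m` with respect to `γ_m`, in the coordinate
`u = (M - 1) y + 1`. -/
noncomputable def transfer (M : ℝ) (H : ℝ → ℝ) (u : ℝ) : ℝ :=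
  ∑' i, weight M i u * H (1 + scale M i / u)

/-- The gauge `|u - v| / (u + v)`, which the inverse branches contract. -/
noncomputable def gauge (u v : ℝ) : ℝ := |u - v| / (u + v)

/-- The partial sums of the weights. -/
noncomputable def weightSum (M : ℝ) (i : ℕ) (u : ℝ) : ℝ :=
  (1 - 1 / M ^ i) * u / (u + scale M i)

section Weights

variable {M : ℝ}

lemma scale_pos (hM : 2 ≤ M) (i : ℕ) : 0 < scale M i := by
  unfold scale
  have : 0 < M - 1 := by linarith
  positivity

lemma scale_le (hM : 2 ≤ M) (i : ℕ) : scale M i ≤ M - 1 :=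
  div_le_self (by linarith) (one_le_pow₀ (by linarith))

lemma scale_succ (i : ℕ) : scale M (i + 1) = scale M i / M := by
  unfold scale
  rw [pow_succ, div_div]

lemma hasSum_scale (hM : 2 ≤ M) : HasSum (scale M) M := by
  have h := (hasSum_geometric_of_lt_one (r := 1 / M) (by positivity)
    (by rw [div_lt_one] <;> linarith)).mul_left (M - 1)
  have e : (M - 1) * (1 - 1 / M)⁻¹ = M := by
    have : M - 1 ≠ 0 := by linarith
    have : M ≠ 0 := by linarith
    field_simp
  rw [e] at h
  have e' : scale M = fun i => (M - 1) * (1 / M) ^ i := by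
    funext i
    simp [scale, div_eq_mul_inv]
  rwa [e']

lemma tendsto_scale (hM : 2 ≤ M) : Tendsto (scale M) atTop (𝓝 0) :=
  (hasSum_scale hM).summable.tendsto_atTop_zero

lemma weight_eq_sub (hM : 2 ≤ M) (i : ℕ) {u : ℝ} (hu : 1 ≤ u) :
    weight M i u = weightSum M (i + 1) u - weightSum M i u := by
  have ha := scale_pos hM i
  have hs : (1 : ℝ) / M ^ i = scale M i / (M - 1) := by
    unfold scale
    have : M - 1 ≠ 0 := by linarith
    field_simp
  have hs' : (1 : ℝ) / M ^ (i + 1) = scale M i / (M - 1) / M := by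
    rw [← hs, pow_succ, div_div]
  unfold weight weightSum
  rw [hs, hs', scale_succ]
  set a := scale M i
  have h1 : M - 1 ≠ 0 := by linarith
  have h2 : M ≠ 0 := by linarith
  have h3 : u + a ≠ 0 := by linarith
  have h4 : M * u + a ≠ 0 := by positivity
  have h5 : u + a / M ≠ 0 := by positivity
  have h6 : u + a / M = (M * u + a) / M := by field_simp
  rw [h6]
  field_simp
  ring

lemma weight_nonneg (hM : 2 ≤ M) (i : ℕ) {u : ℝ} (hu : 1 ≤ u) : 0 ≤ weight M i u := by
  have ha := scale_pos hM i
  unfold weight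
  have : 0 ≤ u + M - 1 := by linarith
  positivity

lemma hasSum_weight (hM : 2 ≤ M) {u : ℝ} (hu : 1 ≤ u) :
    HasSum (fun i => weight M i u) 1 := by
  rw [hasSum_iff_tendsto_nat_of_nonneg fun i => weight_nonneg hM i hu]
  have h : ∀ n : ℕ, ∑ i ∈ Finset.range n, weight M i u = weightSum M n u := fun n => by
    rw [Finset.sum_congr rfl fun i _ => weight_eq_sub hM i hu,
      Finset.sum_range_sub fun i => weightSum M i u]
    simp [weightSum]
  simp_rw [h]
  have hb : Tendsto (fun n : ℕ => 1 / M ^ n) atTop (𝓝 0) := by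
    have := tendsto_pow_atTop_nhds_zero_of_lt_one (r := 1 / M) (by positivity)
      (by rw [div_lt_one] <;> linarith)
    simpa using this
  have h := (((tendsto_const_nhds (x := (1 : ℝ))).sub hb).mul_const u).div
    ((tendsto_const_nhds (x := u)).add (tendsto_scale hM)) (by linarith)
  have e : (1 - 0) * u / (u + 0) = 1 := by
    have : u ≠ 0 := by linarith
    field_simp
    ring
  rwa [e] at h

lemma le_weight (hM : 2 ≤ M) (i : ℕ) {u : ℝ} (hu : 1 ≤ u) :
    scale M i / (2 * M) ≤ weight M i u := by
  have ha := scale_pos hM i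
  have ha' := scale_le hM i
  unfold weight
  set a := scale M i
  have h : (u + a) * (M * u + a) ≤ (u + M - 1) * (2 * M * u) := by
    apply mul_le_mul <;> nlinarith
  rw [div_le_div_iff₀ (by positivity) (by positivity)]
  nlinarith [mul_le_mul_of_nonneg_left h ha.le]

lemma gauge_nonneg {u v : ℝ} (hu : 1 ≤ u) (hv : 1 ≤ v) : 0 ≤ gauge u v := by
  unfold gauge
  positivity

lemma abs_weightSum_sub_le (hM : 2 ≤ M) (i : ℕ) {u v : ℝ} (hu : 1 ≤ u) (hv : 1 ≤ v) :
    |weightSum M i u - weightSum M i v| ≤ 2 * scale M i * gauge u v := by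
  have ha := scale_pos hM i
  unfold weightSum gauge
  set a := scale M i
  have hb : 0 < 1 / M ^ i := by positivity
  have hb' : 1 / M ^ i ≤ 1 := by
    rw [div_le_one (by positivity)]
    exact one_le_pow₀ (by linarith)
  set b := 1 / M ^ i
  have h : (1 - b) * u / (u + a) - (1 - b) * v / (v + a)
      = (1 - b) * a * (u - v) / ((u + a) * (v + a)) := by
    field_simp
    ring
  rw [h, abs_div, abs_mul, abs_of_nonneg (by nlinarith : 0 ≤ (1 - b) * a),
    abs_of_pos (by positivity : 0 < (u + a) * (v + a)), ← mul_div_assoc]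
  have h1 : (1 - b) * a ≤ a := by nlinarith
  have h2 : u + v ≤ 2 * ((u + a) * (v + a)) := by nlinarith
  have h3 := abs_nonneg (u - v)
  rw [div_le_div_iff₀ (by positivity) (by positivity)]
  calc (1 - b) * a * |u - v| * (u + v)
      ≤ a * |u - v| * (2 * ((u + a) * (v + a))) := by gcongr
    _ = _ := by ring

lemma abs_weight_sub_le (hM : 2 ≤ M) (i : ℕ) {u v : ℝ} (hu : 1 ≤ u) (hv : 1 ≤ v) :
    |weight M i u - weight M i v| ≤ scale M i * (4 * gauge u v) := by
  rw [weight_eq_sub hM i hu, weight_eq_sub hM i hv]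
  have h1 := abs_le.1 (abs_weightSum_sub_le hM i hu hv)
  have h2 := abs_le.1 (abs_weightSum_sub_le hM (i + 1) hu hv)
  have hs : scale M (i + 1) ≤ scale M i := by
    rw [scale_succ]
    exact div_le_self (scale_pos hM i).le (by linarith)
  have h3 := mul_le_mul_of_nonneg_right hs (gauge_nonneg hu hv)
  rw [abs_le]
  constructor <;> linarith [h1.1, h1.2, h2.1, h2.2]

lemma branch_mem (hM : 2 ≤ M) (i : ℕ) {u : ℝ} (hu : 1 ≤ u) :
    1 + scale M i / u ∈ Icc 1 M := by
  have ha := scale_pos hM i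
  have h : scale M i / u ≤ scale M i := div_le_self ha.le hu
  have h' : 0 < scale M i / u := by positivity
  constructor <;> linarith [scale_le hM i]

lemma gauge_branch_le (hM : 2 ≤ M) (i : ℕ) {u v : ℝ} (hu : 1 ≤ u) (hv : 1 ≤ v) :
    gauge (1 + scale M i / u) (1 + scale M i / v) ≤ (1 - 1 / M) * gauge u v := by
  have ha := scale_pos hM i
  have ha' := scale_le hM i
  unfold gauge
  set a := scale M i
  have h : (1 + a / u) - (1 + a / v) = a * (v - u) / (u * v) := by
    field_simp
    ring
  have h' : (1 + a / u) + (1 + a / v) = (2 * (u * v) + a * (u + v)) / (u * v) := by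
    field_simp
    ring
  rw [h, h', abs_div, abs_mul, abs_of_pos ha, abs_of_pos (by positivity : 0 < u * v),
    div_div_div_cancel_right₀ (by positivity), abs_sub_comm v u]
  have e : (1 - 1 / M) * (|u - v| / (u + v)) = (M - 1) * |u - v| / (M * (u + v)) := by
    field_simp
  rw [e, div_le_div_iff₀ (by positivity) (by positivity)]
  have h2 : u + v ≤ 2 * (u * v) := by nlinarith
  have h3 : a * (M * (u + v)) ≤ (M - 1) * (2 * (u * v) + a * (u + v)) := by
    nlinarith [mul_nonneg (sub_nonneg.2 ha') (by linarith : 0 ≤ u + v)]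
  calc a * |u - v| * (M * (u + v)) = |u - v| * (a * (M * (u + v))) := by ring
    _ ≤ |u - v| * ((M - 1) * (2 * (u * v) + a * (u + v))) := by gcongr
    _ = _ := by ring

lemma gauge_branch_one_le (hM : 2 ≤ M) (i : ℕ) {u : ℝ} (hu : 1 ≤ u) :
    gauge (1 + scale M i / u) 1 ≤ scale M i / 2 := by
  have ha := scale_pos hM i
  have h : scale M i / u ≤ scale M i := div_le_self ha.le hu
  have h' : 0 < scale M i / u := by positivity
  unfold gauge
  rw [add_sub_cancel_left, abs_of_pos h', div_le_div_iff₀ (by positivity) (by positivity)]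
  nlinarith

end Weights

/-- `H` takes values in `[lo, hi]` on `[1, M]` and is `L`-Lipschitz for the gauge. -/
structure Controlled (M : ℝ) (H : ℝ → ℝ) (lo hi L : ℝ) : Prop where
  mem : ∀ u ∈ Icc 1 M, H u ∈ Icc lo hi
  lip : ∀ u ∈ Icc 1 M, ∀ v ∈ Icc 1 M, |H u - H v| ≤ L * gauge u v

namespace Controlled

variable {M : ℝ} {H : ℝ → ℝ} {lo hi L : ℝ}

lemma nonneg (hM : 2 ≤ M) (h : Controlled M H lo hi L) : 0 ≤ L := by
  have := h.lip 1 ⟨le_rfl, by linarith⟩ 2 ⟨by norm_num, hM⟩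
  have h2 : gauge 1 2 = 1 / 3 := by norm_num [gauge]
  rw [h2] at this
  linarith [abs_nonneg (H 1 - H 2)]

lemma continuousOn (h : Controlled M H lo hi L) (hM : 2 ≤ M) :
    ContinuousOn H (Icc 1 M) := by
  have hL := h.nonneg hM
  refine (LipschitzOnWith.of_dist_le_mul (K := L.toNNReal) fun u hu v hv => ?_).continuousOn
  rw [Real.dist_eq, Real.dist_eq, Real.coe_toNNReal _ hL]
  refine (h.lip u hu v hv).trans (mul_le_mul_of_nonneg_left ?_ hL)
  exact div_le_self (abs_nonneg _) (by linarith [hu.1, hv.1])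

lemma summable (hM : 2 ≤ M) (h : Controlled M H lo hi L) {u : ℝ} (hu : 1 ≤ u) :
    Summable fun i => weight M i u * H (1 + scale M i / u) := by
  refine .of_norm_bounded ((hasSum_weight hM hu).summable.mul_right (max |lo| |hi|))
    fun i => ?_
  have hb := h.mem _ (branch_mem hM i hu)
  rw [norm_mul, Real.norm_of_nonneg (weight_nonneg hM i hu)]
  exact mul_le_mul_of_nonneg_left (abs_le_max_abs_abs hb.1 hb.2) (weight_nonneg hM i hu)

lemma hasSum_transfer_sub (hM : 2 ≤ M) (h : Controlled M H lo hi L) {u : ℝ} (hu : 1 ≤ u)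
    (c : ℝ) :
    HasSum (fun i => weight M i u * (H (1 + scale M i / u) - c)) (transfer M H u - c) := by
  have := (h.summable hM hu).hasSum.sub ((hasSum_weight hM hu).mul_right c)
  simpa [mul_sub, transfer] using this

lemma le_transfer (hM : 2 ≤ M) (h : Controlled M H lo hi L) {u : ℝ} (hu : 1 ≤ u) (k : ℕ) :
    lo + weight M k u * (H (1 + scale M k / u) - lo) ≤ transfer M H u := by
  have := le_hasSum (h.hasSum_transfer_sub hM hu lo) k fun i _ =>
    mul_nonneg (weight_nonneg hM i hu) (sub_nonneg.2 (h.mem _ (branch_mem hM i hu)).1)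
  linarith

lemma transfer_le (hM : 2 ≤ M) (h : Controlled M H lo hi L) {u : ℝ} (hu : 1 ≤ u) (k : ℕ) :
    transfer M H u ≤ hi - weight M k u * (hi - H (1 + scale M k / u)) := by
  have := le_hasSum (h.hasSum_transfer_sub hM hu hi).neg k fun i _ => by
    have := mul_nonneg (weight_nonneg hM i hu)
      (sub_nonneg.2 (h.mem _ (branch_mem hM i hu)).2)
    linarith
  linarith

lemma abs_transfer_sub_le (hM : 2 ≤ M) (h : Controlled M H lo hi L) {u v : ℝ}
    (hu : 1 ≤ u) (hv : 1 ≤ v) :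
    |transfer M H u - transfer M H v| ≤
      ((1 - 1 / M) * L + 4 * M * (hi - lo)) * gauge u v := by
  have hL := h.nonneg hM
  have hs := (h.hasSum_transfer_sub hM hu lo).sub (h.hasSum_transfer_sub hM hv lo)
  rw [sub_sub_sub_cancel_right] at hs
  rw [← hs.tsum_eq]
  have hg := ((hasSum_weight hM hu).mul_right ((1 - 1 / M) * L * gauge u v)).add
    ((hasSum_scale hM).mul_right (4 * gauge u v * (hi - lo)))
  have hr : 1 * ((1 - 1 / M) * L * gauge u v) + M * (4 * gauge u v * (hi - lo))
      = ((1 - 1 / M) * L + 4 * M * (hi - lo)) * gauge u v := by ring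
  rw [hr] at hg
  rw [← Real.norm_eq_abs]
  refine tsum_of_norm_bounded hg fun i => ?_
  set x := 1 + scale M i / u
  set y := 1 + scale M i / v
  have hx := branch_mem hM i hu
  have hy := branch_mem hM i hv
  have e : weight M i u * (H x - lo) - weight M i v * (H y - lo)
      = weight M i u * (H x - H y) + (weight M i u - weight M i v) * (H y - lo) := by ring
  rw [e]
  refine (norm_add_le _ _).trans (add_le_add ?_ ?_)
  · rw [norm_mul, Real.norm_of_nonneg (weight_nonneg hM i hu)]
    refine mul_le_mul_of_nonneg_left ((h.lip x hx y hy).trans ?_) (weight_nonneg hM i hu)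
    calc L * gauge x y ≤ L * ((1 - 1 / M) * gauge u v) :=
          mul_le_mul_of_nonneg_left (gauge_branch_le hM i hu hv) hL
      _ = _ := by ring
  · have hH := h.mem y hy
    rw [norm_mul, Real.norm_of_nonneg (sub_nonneg.2 hH.1), Real.norm_eq_abs, ← mul_assoc]
    exact mul_le_mul (abs_weight_sub_le hM i hu hv) (by linarith [hH.2])
      (sub_nonneg.2 hH.1) ((abs_nonneg _).trans (abs_weight_sub_le hM i hu hv))

lemma transfer_control (hM : 2 ≤ M) (h : Controlled M H lo hi L) (k : ℕ) :
    ∃ lo' hi', Controlled M (transfer M H) lo' hi'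
        ((1 - 1 / M) * L + 4 * M * (hi - lo)) ∧
      hi' - lo' = (1 - scale M k / (2 * M)) * (hi - lo)
        + scale M k / (2 * M) * scale M k * L := by
  have hL := h.nonneg hM
  have ha := scale_pos hM k
  have hp : 0 < scale M k / (2 * M) := by positivity
  have key : ∀ u ∈ Icc 1 M, |H (1 + scale M k / u) - H 1| ≤ L * (scale M k / 2) :=
    fun u hu => (h.lip _ (branch_mem hM k hu.1) 1 ⟨le_rfl, by linarith⟩).trans
      (mul_le_mul_of_nonneg_left (gauge_branch_one_le hM k hu.1) hL)
  refine ⟨(1 - scale M k / (2 * M)) * lo + scale M k / (2 * M) * (H 1 - L * (scale M k / 2)),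
    (1 - scale M k / (2 * M)) * hi + scale M k / (2 * M) * (H 1 + L * (scale M k / 2)),
    ⟨fun u hu => ?_, fun u hu v hv => h.abs_transfer_sub_le hM hu.1 hv.1⟩, by ring⟩
  have hb := h.mem _ (branch_mem hM k hu.1)
  have hw := le_weight hM k hu.1
  have hk := abs_le.1 (key u hu)
  have h1 := h.le_transfer hM hu.1 k
  have h2 := h.transfer_le hM hu.1 k
  set p := scale M k / (2 * M)
  set x := H (1 + scale M k / u)
  have h3 := mul_le_mul_of_nonneg_right hw (sub_nonneg.2 hb.1)
  have h4 := mul_le_mul_of_nonneg_right hw (sub_nonneg.2 hb.2)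
  have h5 := mul_le_mul_of_nonneg_left hk.1 hp.le
  have h6 := mul_le_mul_of_nonneg_left hk.2 hp.le
  constructor <;> linarith

/-- The oscillation of the iterates of the transfer operator tends to zero. -/
lemma exists_iterate (hM : 2 ≤ M) (h : Controlled M H lo hi L) :
    ∃ ε : ℕ → ℝ, Tendsto ε atTop (𝓝 0) ∧ ∀ n, ∃ lo' hi' L',
      Controlled M ((transfer M)^[n] H) lo' hi' L' ∧ hi' - lo' ≤ ε n := by
  obtain ⟨k, hk⟩ := ((tendsto_scale hM).eventually_lt_const
    (by positivity : 0 < 1 / (16 * M ^ 2))).exists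
  have ha := scale_pos hM k
  set a := scale M k
  set p := a / (2 * M) with hp
  have hp0 : 0 < p := by positivity
  have hM0 : 0 < M := by linarith
  have haM : 8 * M * a ≤ 1 / (2 * M) := by
    have : 8 * M * a ≤ 8 * M * (1 / (16 * M ^ 2)) := by gcongr
    refine this.trans (le_of_eq ?_)
    field_simp
    norm_num
  have hpM : p ≤ 1 / M := by
    rw [hp, div_le_div_iff₀ (by positivity) hM0]
    nlinarith [scale_le hM k, (div_le_one (by positivity : 0 < 2 * M)).2 (by linarith : 1 ≤ 2 * M)]
  have hM1 : 1 / M ≤ 1 := (div_le_one hM0).2 (by linarith)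
  set κ := p / (8 * M) with hκ
  have hκ0 : 0 < κ := by positivity
  have hpκ : p = 8 * M * κ := by
    rw [hκ]
    field_simp
  set N := hi - lo + κ * L
  refine ⟨fun n => (1 - p / 2) ^ n * N, ?_, fun n => ?_⟩
  · simpa using (tendsto_pow_atTop_nhds_zero_of_lt_one (by linarith : 0 ≤ 1 - p / 2)
      (by linarith)).mul_const N
  · suffices ∃ lo' hi' L', Controlled M ((transfer M)^[n] H) lo' hi' L' ∧
        hi' - lo' + κ * L' ≤ (1 - p / 2) ^ n * N by
      obtain ⟨lo', hi', L', hc, hN⟩ := this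
      exact ⟨lo', hi', L', hc, by nlinarith [hc.nonneg hM]⟩
    induction n with
    | zero => exact ⟨lo, hi, L, h, by simp [N]⟩
    | succ n ih =>
      obtain ⟨lo₁, hi₁, L₁, hc, hN⟩ := ih
      obtain ⟨lo', hi', hc', hN'⟩ := hc.transfer_control hM k
      rw [Function.iterate_succ_apply']
      refine ⟨lo', hi', _, hc', ?_⟩
      have hL₁ := hc.nonneg hM
      have h1 : hi' - lo' + κ * ((1 - 1 / M) * L₁ + 4 * M * (hi₁ - lo₁))
          = (1 - p / 2) * (hi₁ - lo₁) + (8 * M * a + (1 - 1 / M)) * (κ * L₁) := by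
        rw [hN']
        linear_combination (hi₁ - lo₁) * (- 1 / 2) * hpκ + a * L₁ * hpκ
      have h2 : 8 * M * a + (1 - 1 / M) ≤ 1 - p / 2 := by
        have : 1 / (2 * M) = 1 / M / 2 := by
          field_simp
        linarith
      rw [h1, pow_succ', mul_assoc]
      have h3 := mul_le_mul_of_nonneg_right h2 (mul_nonneg hκ0.le hL₁)
      have h4 := mul_le_mul_of_nonneg_left hN (by linarith : 0 ≤ 1 - p / 2)
      linarith

end Controlled

/-- The `i`-th inverse branch of `τ_m`. -/
noncomputable def branch (m i : ℕ) (y : ℝ) : ℝ := 1 / ((m : ℝ) ^ i * (((m : ℝ) - 1) * y + 1))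

section Branches

variable {m : ℕ}

lemma two_le_cast (hm : 2 ≤ m) : (2 : ℝ) ≤ m := by exact_mod_cast hm

lemma coord_mem (hm : 2 ≤ m) {y : ℝ} (hy : y ∈ Icc (0 : ℝ) 1) :
    ((m : ℝ) - 1) * y + 1 ∈ Icc 1 (m : ℝ) := by
  have := two_le_cast hm
  constructor <;> nlinarith [hy.1, hy.2]

lemma floor_branch (hm : 2 ≤ m) (i : ℕ) {y : ℝ} (hy : y ∈ Ico (0 : ℝ) 1) :
    ⌊-Real.logb m (branch m i y)⌋ = i := by
  have hM := two_le_cast hm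
  have hu := (coord_mem hm (Ico_subset_Icc_self hy)).1
  have hu' : ((m : ℝ) - 1) * y + 1 < m := by nlinarith [hy.2]
  have h1 : (1 : ℝ) < m := by linarith
  unfold branch
  rw [one_div, Real.logb_inv, neg_neg, Real.logb_mul (by positivity) (by linarith),
    Real.logb_pow, Real.logb_self_eq_one h1, mul_one, Int.floor_eq_iff]
  have h2 := Real.logb_nonneg h1 hu
  have h3 : Real.logb m (((m : ℝ) - 1) * y + 1) < 1 := by
    rw [Real.logb_lt_iff_lt_rpow h1 (by linarith), Real.rpow_one]
    exact hu'
  push_cast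
  constructor <;> linarith

lemma branch_pos (hm : 2 ≤ m) (i : ℕ) {y : ℝ} (hy : y ∈ Icc (0 : ℝ) 1) :
    0 < branch m i y := by
  have hM := two_le_cast hm
  have hu := (coord_mem hm hy).1
  unfold branch
  positivity

lemma branch_le_one (hm : 2 ≤ m) (i : ℕ) {y : ℝ} (hy : y ∈ Icc (0 : ℝ) 1) :
    branch m i y ≤ 1 := by
  have hM := two_le_cast hm
  have hu := (coord_mem hm hy).1
  unfold branch
  rw [div_le_one (by positivity)]
  exact one_le_mul_of_one_le_of_one_le (one_le_pow₀ (by linarith)) hu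

lemma chanTau_branch (hm : 2 ≤ m) (i : ℕ) {y : ℝ} (hy : y ∈ Ico (0 : ℝ) 1) :
    chanTau m (branch m i y) = y := by
  have hM := two_le_cast hm
  have hu := (coord_mem hm (Ico_subset_Icc_self hy)).1
  rw [chanTau, if_neg (branch_pos hm i (Ico_subset_Icc_self hy)).ne', floor_branch hm i hy,
    zpow_natCast, branch]
  have : (m : ℝ) - 1 ≠ 0 := by linarith
  have : (m : ℝ) ≠ 0 := by linarith
  have : ((m : ℝ) - 1) * y + 1 ≠ 0 := by linarith
  field_simp
  ring

lemma injOn_branch (hm : 2 ≤ m) (i : ℕ) : InjOn (branch m i) (Ico 0 1) :=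
  fun x hx y hy h => by rw [← chanTau_branch hm i hx, h, chanTau_branch hm i hy]

lemma disjoint_image_branch (hm : 2 ≤ m) :
    Pairwise (Function.onFun Disjoint fun i => branch m i '' Ico 0 1) := by
  intro i j hij
  refine Set.disjoint_left.2 ?_
  rintro _ ⟨x, hx, rfl⟩ ⟨y, hy, h⟩
  refine hij ?_
  have := floor_branch hm i hx
  rw [← h, floor_branch hm j hy] at this
  exact_mod_cast this.symm

lemma iUnion_image_branch (hm : 2 ≤ m) : ⋃ i, branch m i '' Ico 0 1 = Ioc 0 1 := by
  have hM := two_le_cast hm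
  have h1 : (1 : ℝ) < m := by linarith
  ext t
  simp only [mem_iUnion]
  constructor
  · rintro ⟨i, y, hy, rfl⟩
    exact ⟨branch_pos hm i (Ico_subset_Icc_self hy), branch_le_one hm i (Ico_subset_Icc_self hy)⟩
  · intro ht
    have ht0 := ht.1
    have hl : 0 ≤ Real.logb m t⁻¹ := Real.logb_nonneg h1 (one_le_inv₀ ht0 |>.2 ht.2)
    set i := ⌊Real.logb m t⁻¹⌋₊ with hi
    have hi1 : (m : ℝ) ^ i * t ≤ 1 := by
      have h := Nat.floor_le hl
      rw [Real.le_logb_iff_rpow_le h1 (by positivity), Real.rpow_natCast,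
        le_inv_comm₀ (by positivity) ht0] at h
      rwa [← le_div_iff₀' (by positivity), one_div]
    have hi2 : 1 < (m : ℝ) ^ i * t * m := by
      have h := Nat.lt_floor_add_one (Real.logb m t⁻¹)
      rw [← hi, Real.logb_lt_iff_lt_rpow h1 (by positivity), ← Nat.cast_add_one,
        Real.rpow_natCast, inv_lt_iff_one_lt_mul₀ ht0, pow_succ] at h
      linarith
    have hs : 0 < (m : ℝ) ^ i * t := by positivity
    refine ⟨i, 1 / ((m : ℝ) - 1) * (1 / ((m : ℝ) ^ i * t) - 1), ⟨?_, ?_⟩, ?_⟩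
    · have : 1 ≤ 1 / ((m : ℝ) ^ i * t) := by rwa [le_div_iff₀ hs, one_mul]
      exact mul_nonneg (by rw [one_div_nonneg]; linarith) (by linarith)
    · have : 1 / ((m : ℝ) ^ i * t) < m := by
        rw [div_lt_iff₀ hs]
        linarith
      rw [one_div_mul_eq_div, div_lt_one (by linarith)]
      linarith
    · have : (m : ℝ) - 1 ≠ 0 := by linarith
      unfold branch
      field_simp
      ring

lemma hasDerivAt_branch (hm : 2 ≤ m) (i : ℕ) {y : ℝ} (hy : y ∈ Icc (0 : ℝ) 1) :
    HasDerivAt (branch m i) (-(scale m i / (((m : ℝ) - 1) * y + 1) ^ 2)) y := by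
  have hM := two_le_cast hm
  have hu := (coord_mem hm hy).1
  have h := (((hasDerivAt_id y).const_mul ((m : ℝ) - 1)).add_const 1).const_mul ((m : ℝ) ^ i)
  have h' := h.inv (by simp only [id]; positivity)
  have e : branch m i = (fun y => (m : ℝ) ^ i * (((m : ℝ) - 1) * id y + 1))⁻¹ := by
    funext z
    simp [branch]
  rw [e]
  refine h'.congr_deriv ?_
  have : ((m : ℝ) - 1) * y + 1 ≠ 0 := by linarith
  simp only [id, scale]
  field_simp

lemma chanK_pos (hm : 2 ≤ m) : 0 < chanK m := by
  have hM := two_le_cast hm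
  have : 0 < (m : ℝ) - 1 := by linarith
  refine div_pos (by positivity) (Real.log_pos ?_)
  rw [lt_div_iff₀ (by linarith)]
  nlinarith

lemma chanRho_pos (hm : 2 ≤ m) {y : ℝ} (hy : y ∈ Icc (0 : ℝ) 1) : 0 < chanRho m y := by
  have hM := two_le_cast hm
  have hu := (coord_mem hm hy).1
  have : 0 < ((m : ℝ) - 1) * y + m := by linarith
  exact div_pos (chanK_pos hm) (by positivity)

lemma continuousOn_chanRho (hm : 2 ≤ m) : ContinuousOn (chanRho m) (Icc 0 1) := by
  have hM := two_le_cast hm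
  unfold chanRho
  refine ContinuousOn.div (by fun_prop) (by fun_prop) fun y hy => ?_
  have hu := (coord_mem hm hy).1
  have : 0 < ((m : ℝ) - 1) * y + m := by linarith
  positivity

lemma coord_branch (i : ℕ) (y : ℝ) :
    ((m : ℝ) - 1) * branch m i y + 1 = 1 + scale m i / (((m : ℝ) - 1) * y + 1) := by
  unfold branch scale
  rw [mul_one_div, div_div, add_comm]

lemma deriv_mul_chanRho_branch (hm : 2 ≤ m) (i : ℕ) {y : ℝ} (hy : y ∈ Icc (0 : ℝ) 1) :
    scale m i / (((m : ℝ) - 1) * y + 1) ^ 2 * chanRho m (branch m i y)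
      = chanRho m y * weight m i (((m : ℝ) - 1) * y + 1) := by
  have hM := two_le_cast hm
  have ha := scale_pos hM i
  have hu := (coord_mem hm hy).1
  have e1 := coord_branch (m := m) i y
  have e2 : ((m : ℝ) - 1) * branch m i y + m
      = scale m i / (((m : ℝ) - 1) * y + 1) + m := by linarith
  have e3 : ((m : ℝ) - 1) * y + m = (((m : ℝ) - 1) * y + 1) + m - 1 := by ring
  unfold chanRho weight
  rw [e1, e2, e3]
  set u := ((m : ℝ) - 1) * y + 1
  set a := scale (m : ℝ) i
  have h3 : u + m - 1 ≠ 0 := by linarith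
  have h4 : m * u + a ≠ 0 := by positivity
  have h5 : a / u + m = (m * u + a) / u := by
    field_simp
    ring
  have h6 : 1 + a / u = (u + a) / u := by field_simp
  rw [h5, h6]
  field_simp

lemma measurable_chanTau (m : ℕ) : Measurable (chanTau m) := by
  unfold chanTau
  refine Measurable.ite (measurableSet_singleton 0) measurable_const ?_
  have h : Measurable fun x : ℝ => (m : ℝ) ^ ⌊-Real.logb m x⌋ :=
    (measurable_from_top (f := fun k : ℤ => (m : ℝ) ^ k)).comp
      (Int.measurable_floor.comp (by unfold Real.logb; fun_prop))
  fun_prop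

end Branches

/-- The measure with density `H ((m - 1) y + 1)` with respect to `γ_m`. -/
noncomputable def densityMeasure (m : ℕ) (H : ℝ → ℝ) : Measure ℝ :=
  (volume.restrict (Icc (0 : ℝ) 1)).withDensity
    fun y => ENNReal.ofReal (chanRho m y * H (((m : ℝ) - 1) * y + 1))

section Densities

variable {m : ℕ} {H : ℝ → ℝ} {lo hi L : ℝ}

lemma continuousOn_density (hm : 2 ≤ m) (h : ContinuousOn H (Icc 1 (m : ℝ))) :
    ContinuousOn (fun y => chanRho m y * H (((m : ℝ) - 1) * y + 1)) (Icc 0 1) :=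
  (continuousOn_chanRho hm).mul (h.comp (by fun_prop) fun _ hy => coord_mem hm hy)

/-- The push-forward under `τ_m` acts on densities as the transfer operator. -/
lemma map_densityMeasure (hm : 2 ≤ m) (h : Controlled m H lo hi L)
    (h0 : ∀ u ∈ Icc 1 (m : ℝ), 0 ≤ H u) :
    (densityMeasure m H).map (chanTau m) = densityMeasure m (transfer m H) := by
  have hM := two_le_cast hm
  set f : ℝ → ENNReal := fun y => ENNReal.ofReal (chanRho m y * H (((m : ℝ) - 1) * y + 1))
  ext A hA
  have hτ := measurable_chanTau m
  rw [Measure.map_apply hτ hA, densityMeasure, densityMeasure, withDensity_apply _ (hτ hA),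
    withDensity_apply _ hA, ← lintegral_indicator (hτ hA), ← lintegral_indicator hA,
    ← restrict_Ioc_eq_restrict_Icc, ← iUnion_image_branch hm,
    lintegral_iUnion (fun i => measurableSet_Ico.image_of_continuousOn_injOn
      (fun y hy => (hasDerivAt_branch hm i (Ico_subset_Icc_self hy)).continuousAt.continuousWithinAt)
      (injOn_branch hm i)) (disjoint_image_branch hm), iUnion_image_branch hm,
    restrict_Ioc_eq_restrict_Icc, ← restrict_Ico_eq_restrict_Icc]
  have hbranch : ∀ i, ∫⁻ t in branch m i '' Ico 0 1, (chanTau m ⁻¹' A).indicator f t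
      = ∫⁻ y in Ico 0 1, A.indicator (fun y => ENNReal.ofReal (chanRho m y *
        (weight m i (((m : ℝ) - 1) * y + 1) *
          H (1 + scale m i / (((m : ℝ) - 1) * y + 1))))) y := fun i => by
    rw [lintegral_image_eq_lintegral_abs_deriv_mul measurableSet_Ico
      (fun y hy => (hasDerivAt_branch hm i (Ico_subset_Icc_self hy)).hasDerivWithinAt)
      (injOn_branch hm i)]
    refine setLIntegral_congr_fun measurableSet_Ico fun y hy => ?_
    have hy' := Ico_subset_Icc_self hy
    have hu := (coord_mem hm hy').1
    have ha := scale_pos hM i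
    by_cases hyA : y ∈ A
    · rw [indicator_of_mem (by rwa [mem_preimage, chanTau_branch hm i hy]),
        indicator_of_mem hyA, abs_neg, abs_of_nonneg (by positivity),
        ← ENNReal.ofReal_mul (by positivity), ← mul_assoc, deriv_mul_chanRho_branch hm i hy',
        coord_branch, mul_assoc]
    · rw [indicator_of_notMem (by rwa [mem_preimage, chanTau_branch hm i hy]),
        indicator_of_notMem hyA, mul_zero]
  refine (tsum_congr hbranch).trans ?_
  rw [← lintegral_tsum]
  · refine setLIntegral_congr_fun measurableSet_Ico fun y hy => ?_
    have hy' := Ico_subset_Icc_self hy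
    have hu := (coord_mem hm hy').1
    by_cases hyA : y ∈ A
    · simp only [indicator_of_mem hyA]
      rw [← ENNReal.ofReal_tsum_of_nonneg, tsum_mul_left, transfer]
      · exact fun i => mul_nonneg (chanRho_pos hm hy').le
          (mul_nonneg (weight_nonneg hM i hu) (h0 _ (branch_mem hM i hu)))
      · exact (h.summable hM hu).mul_left _
    · simp [indicator_of_notMem hyA]
  · intro i
    refine AEMeasurable.indicator (ContinuousOn.aemeasurable ?_ measurableSet_Ico).ennreal_ofReal hA
    have hmaps : ∀ y ∈ Ico (0 : ℝ) 1, 1 ≤ ((m : ℝ) - 1) * y + 1 :=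
      fun y hy => (coord_mem hm (Ico_subset_Icc_self hy)).1
    have ha := scale_pos hM i
    refine ((continuousOn_chanRho hm).mono Ico_subset_Icc_self).mul (.mul ?_ ?_)
    · unfold weight
      refine ContinuousOn.div (by fun_prop) (by fun_prop) fun y hy => ?_
      have := hmaps y hy
      positivity
    · refine (h.continuousOn hM).comp ?_ fun y hy => branch_mem hM i (hmaps y hy)
      refine continuousOn_const.add (ContinuousOn.div (by fun_prop) (by fun_prop) fun y hy => ?_)
      linarith [hmaps y hy]

lemma transfer_nonneg (hM : 2 ≤ (m : ℝ)) (h0 : ∀ u ∈ Icc 1 (m : ℝ), 0 ≤ H u) :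
    ∀ u ∈ Icc 1 (m : ℝ), 0 ≤ transfer m H u := fun _ hu =>
  tsum_nonneg fun i => mul_nonneg (weight_nonneg hM i hu.1) (h0 _ (branch_mem hM i hu.1))

lemma map_iterate_densityMeasure (hm : 2 ≤ m) (h : Controlled m H lo hi L)
    (h0 : ∀ u ∈ Icc 1 (m : ℝ), 0 ≤ H u) (n : ℕ) :
    (densityMeasure m H).map (chanTau m)^[n] = densityMeasure m ((transfer m)^[n] H) ∧
      ∀ u ∈ Icc 1 (m : ℝ), 0 ≤ (transfer m)^[n] H u := by
  have hM := two_le_cast hm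
  obtain ⟨ε, -, hε⟩ := h.exists_iterate hM
  induction n with
  | zero => simpa using h0
  | succ n ih =>
    obtain ⟨lo', hi', L', hc, -⟩ := hε n
    rw [Function.iterate_succ', Function.iterate_succ_apply', ← Measure.map_map
      (measurable_chanTau m) ((measurable_chanTau m).iterate n), ih.1,
      map_densityMeasure hm hc ih.2]
    exact ⟨rfl, transfer_nonneg hM ih.2⟩

end Densities

section Limit

variable {m : ℕ} {H : ℝ → ℝ}

lemma densityMeasure_compl (m : ℕ) (H : ℝ → ℝ) : densityMeasure m H (Icc 0 1)ᶜ = 0 := by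
  rw [densityMeasure, withDensity_apply _ measurableSet_Icc.compl,
    Measure.restrict_restrict measurableSet_Icc.compl, compl_inter_self, Measure.restrict_empty,
    lintegral_zero_measure]

lemma intervalIntegrable_density (hm : 2 ≤ m) (h : ContinuousOn H (Icc 1 (m : ℝ))) {x : ℝ}
    (hx : x ∈ Icc (0 : ℝ) 1) :
    IntervalIntegrable (fun y => chanRho m y * H (((m : ℝ) - 1) * y + 1)) volume 0 x :=
  ((continuousOn_density hm h).mono (Icc_subset_Icc_right hx.2)).intervalIntegrable_of_Icc hx.1

lemma Iic_inter_Icc_of_le_one {x : ℝ} (hx : x ≤ 1) : Iic x ∩ Icc 0 1 = Icc 0 x := by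
  ext y
  simp only [mem_inter_iff, mem_Iic, mem_Icc]
  exact ⟨fun h => ⟨h.2.1, h.1⟩, fun h => ⟨h.2, h.1, h.2.trans hx⟩⟩

lemma densityMeasure_Iic (hm : 2 ≤ m) (h : ContinuousOn H (Icc 1 (m : ℝ)))
    (h0 : ∀ u ∈ Icc 1 (m : ℝ), 0 ≤ H u) {x : ℝ} (hx : x ∈ Icc (0 : ℝ) 1) :
    densityMeasure m H (Iic x)
      = ENNReal.ofReal (∫ y in (0 : ℝ)..x, chanRho m y * H (((m : ℝ) - 1) * y + 1)) := by
  rw [densityMeasure, withDensity_apply _ measurableSet_Iic,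
    Measure.restrict_restrict measurableSet_Iic, Iic_inter_Icc_of_le_one hx.2,
    intervalIntegral.integral_of_le hx.1,
    ← integral_Icc_eq_integral_Ioc, ofReal_integral_eq_lintegral_ofReal]
  · exact ((continuousOn_density hm h).mono (Icc_subset_Icc_right hx.2)).integrableOn_Icc
  · filter_upwards [ae_restrict_mem measurableSet_Icc] with y hy
    have hy' : y ∈ Icc (0 : ℝ) 1 := ⟨hy.1, hy.2.trans hx.2⟩
    exact mul_nonneg (chanRho_pos hm hy').le (h0 _ (coord_mem hm hy'))

lemma integral_density_nonneg (hm : 2 ≤ m) (h0 : ∀ u ∈ Icc 1 (m : ℝ), 0 ≤ H u) {x : ℝ}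
    (hx : x ∈ Icc (0 : ℝ) 1) :
    0 ≤ ∫ y in (0 : ℝ)..x, chanRho m y * H (((m : ℝ) - 1) * y + 1) :=
  intervalIntegral.integral_nonneg hx.1 fun y hy =>
    have hy' : y ∈ Icc (0 : ℝ) 1 := ⟨hy.1, hy.2.trans hx.2⟩
    mul_nonneg (chanRho_pos hm hy').le (h0 _ (coord_mem hm hy'))

lemma chanGamma_Icc (hm : 2 ≤ m) {x : ℝ} (hx : x ∈ Icc (0 : ℝ) 1) :
    (chanGamma m (Icc 0 x)).toReal = ∫ y in (0 : ℝ)..x, chanRho m y := by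
  have e : chanGamma m = densityMeasure m fun _ => 1 := by simp [chanGamma, densityMeasure]
  have h := densityMeasure_Iic (H := fun _ => 1) hm continuousOn_const (fun _ _ => zero_le_one) hx
  have h0 := integral_density_nonneg (H := fun _ => 1) hm (fun _ _ => zero_le_one) hx
  rw [e, ← Iic_inter_Icc_of_le_one hx.2, measure_inter_conull (densityMeasure_compl m _), h,
    ENNReal.toReal_ofReal h0]
  simp

lemma integral_chanRho (hm : 2 ≤ m) : ∫ y in (0 : ℝ)..1, chanRho m y = 1 := by
  have hM := two_le_cast hm
  have hm1 : (m : ℝ) - 1 ≠ 0 := by linarith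
  have hlog : Real.log ((m : ℝ) ^ 2 / (2 * m - 1)) ≠ 0 := by
    refine (Real.log_pos ?_).ne'
    rw [lt_div_iff₀ (by linarith)]
    nlinarith
  have hder : ∀ y ∈ Icc (0 : ℝ) 1, HasDerivAt (fun y => chanK m / ((m : ℝ) - 1) ^ 2 *
      (Real.log (((m : ℝ) - 1) * y + 1) - Real.log (((m : ℝ) - 1) * y + m)))
      (chanRho m y) y := fun y hy => by
    have hu := (coord_mem hm hy).1
    have h1 : ((m : ℝ) - 1) * y + 1 ≠ 0 := by linarith
    have h2 : ((m : ℝ) - 1) * y + m ≠ 0 := by linarith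
    have d1 := (((hasDerivAt_id y).const_mul ((m : ℝ) - 1)).add_const 1).log h1
    have d2 := (((hasDerivAt_id y).const_mul ((m : ℝ) - 1)).add_const (m : ℝ)).log h2
    refine ((d1.sub d2).const_mul (chanK m / ((m : ℝ) - 1) ^ 2)).congr_deriv ?_
    simp only [id, chanRho]
    field_simp
    ring
  rw [intervalIntegral.integral_eq_sub_of_hasDerivAt_of_le zero_le_one
    (fun y hy => (hder y hy).continuousAt.continuousWithinAt)
    (fun y hy => hder y (Ioo_subset_Icc_self hy))
    ((continuousOn_chanRho hm).intervalIntegrable_of_Icc zero_le_one)]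
  have e1 : Real.log ((m : ℝ) ^ 2 / (2 * m - 1))
      = 2 * Real.log m - Real.log (2 * m - 1) := by
    rw [Real.log_div (by positivity) (by linarith), Real.log_pow]
    norm_num
  have e2 : ((m : ℝ) - 1) * 1 + m = 2 * m - 1 := by ring
  have e3 : ((m : ℝ) - 1) * 1 + 1 = m := by ring
  simp only [mul_zero, zero_add, Real.log_one, e2, e3]
  rw [← mul_sub, show Real.log m - Real.log (2 * m - 1) - (0 - Real.log m)
    = Real.log ((m : ℝ) ^ 2 / (2 * m - 1)) by rw [e1]; ring, chanK]
  rw [div_div, mul_comm (Real.log _), ← div_div, div_self (pow_ne_zero 2 hm1),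
    one_div_mul_cancel hlog]

/-- Probability densities that are regular for the gauge converge, in distribution, to that
of `γ_m`. -/
lemma tendsto_integral_iterate (hm : 2 ≤ m) {lo hi L : ℝ} (h : Controlled m H lo hi L)
    (h0 : ∀ u ∈ Icc 1 (m : ℝ), 0 ≤ H u) [IsProbabilityMeasure (densityMeasure m H)]
    {x : ℝ} (hx : x ∈ Icc (0 : ℝ) 1) :
    Tendsto (fun n => (densityMeasure m H ((chanTau m)^[n] ⁻¹' Iic x)).toReal) atTop
      (𝓝 (∫ y in (0 : ℝ)..x, chanRho m y)) := by
  have hM := two_le_cast hm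
  obtain ⟨ε, hε, hn⟩ := h.exists_iterate hM
  have hone : (1 : ℝ) ∈ Icc (0 : ℝ) 1 := ⟨zero_le_one, le_rfl⟩
  have hρ : ∀ {x : ℝ}, x ∈ Icc (0 : ℝ) 1 → IntervalIntegrable (chanRho m) volume 0 x :=
    fun hx => ((continuousOn_chanRho hm).mono (Icc_subset_Icc_right hx.2)).intervalIntegrable_of_Icc
      hx.1
  rw [tendsto_iff_dist_tendsto_zero]
  refine squeeze_zero (fun _ => dist_nonneg) (fun n => ?_)
    (by simpa using hε.mul_const (∫ y in (0 : ℝ)..x, chanRho m y))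
  obtain ⟨lo', hi', L', hc, hosc⟩ := hn n
  obtain ⟨hmap, hpos⟩ := map_iterate_densityMeasure hm h h0 n
  set K := (transfer m)^[n] H
  have hcont := hc.continuousOn hM
  have hint := fun {x : ℝ} (hx : x ∈ Icc (0 : ℝ) 1) => intervalIntegrable_density hm hcont hx
  have hmeas := (measurable_chanTau m).iterate n
  have htot : ∫ y in (0 : ℝ)..1, chanRho m y * K (((m : ℝ) - 1) * y + 1) = 1 := by
    have : IsProbabilityMeasure (densityMeasure m K) :=
      hmap ▸ Measure.isProbabilityMeasure_map hmeas.aemeasurable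
    have h1 : densityMeasure m K (Iic 1) = 1 := by
      refine (prob_compl_eq_zero_iff measurableSet_Iic).1
        (measure_mono_null ?_ (densityMeasure_compl m K))
      exact compl_subset_compl.2 Icc_subset_Iic_self
    rw [densityMeasure_Iic hm hcont hpos hone] at h1
    simpa using h1
  have hconst : ∀ c : ℝ, ∫ y in (0 : ℝ)..1, c * chanRho m y = c := fun c => by
    rw [intervalIntegral.integral_const_mul, integral_chanRho hm, mul_one]
  have hlo : lo' ≤ 1 := by
    rw [← htot, ← hconst lo']
    refine intervalIntegral.integral_mono_on zero_le_one ((hρ hone).const_mul _) (hint hone)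
      fun y hy => ?_
    rw [mul_comm]
    exact mul_le_mul_of_nonneg_left (hc.mem _ (coord_mem hm hy)).1 (chanRho_pos hm hy).le
  have hhi : 1 ≤ hi' := by
    rw [← htot, ← hconst hi']
    refine intervalIntegral.integral_mono_on zero_le_one (hint hone) ((hρ hone).const_mul _)
      fun y hy => ?_
    rw [mul_comm hi']
    exact mul_le_mul_of_nonneg_left (hc.mem _ (coord_mem hm hy)).2 (chanRho_pos hm hy).le
  rw [← Measure.map_apply hmeas measurableSet_Iic, hmap, densityMeasure_Iic hm hcont hpos hx,
    ENNReal.toReal_ofReal (integral_density_nonneg hm hpos hx), Real.dist_eq,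
    ← intervalIntegral.integral_sub (hint hx) (hρ hx), ← intervalIntegral.integral_const_mul,
    ← Real.norm_eq_abs]
  refine intervalIntegral.norm_integral_le_of_norm_le hx.1 (ae_of_all _ fun y hy => ?_)
    ((hρ hx).const_mul _)
  have hy' : y ∈ Icc (0 : ℝ) 1 := ⟨hy.1.le, hy.2.trans hx.2⟩
  have hmem := hc.mem _ (coord_mem hm hy')
  rw [← mul_sub_one, norm_mul, Real.norm_of_nonneg (chanRho_pos hm hy').le, mul_comm,
    Real.norm_eq_abs]
  refine mul_le_mul_of_nonneg_right (abs_le.2 ⟨?_, ?_⟩) (chanRho_pos hm hy').le <;>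
    linarith [hmem.1, hmem.2]

/-- A `C¹` function on `[0, 1]`, read in the coordinate `u = (m - 1) y + 1`, is controlled. -/
lemma exists_controlled_of_contDiffOn (hm : 2 ≤ m) {g : ℝ → ℝ}
    (hg : ContDiffOn ℝ 1 g (Icc 0 1)) :
    ∃ lo hi L, Controlled m (fun u => g ((u - 1) / ((m : ℝ) - 1))) lo hi L := by
  have hM := two_le_cast hm
  have hm1 : 0 < (m : ℝ) - 1 := by linarith
  have hmaps : ∀ u ∈ Icc 1 (m : ℝ), (u - 1) / ((m : ℝ) - 1) ∈ Icc (0 : ℝ) 1 := fun u hu =>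
    ⟨div_nonneg (by linarith [hu.1]) hm1.le, (div_le_one hm1).2 (by linarith [hu.2])⟩
  obtain ⟨C, hC⟩ := isCompact_Icc.exists_bound_of_continuousOn hg.continuousOn
  obtain ⟨K, hK⟩ := hg.exists_lipschitzOnWith one_ne_zero (convex_Icc 0 1) isCompact_Icc
  refine ⟨-C, C, K * (2 * m / (m - 1)), fun u hu => abs_le.1 (hC _ (hmaps u hu)),
    fun u hu v hv => ?_⟩
  have h := hK.dist_le_mul _ (hmaps u hu) _ (hmaps v hv)
  rw [Real.dist_eq, Real.dist_eq] at h
  refine h.trans ?_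
  rw [mul_assoc]
  refine mul_le_mul_of_nonneg_left ?_ K.2
  rw [← sub_div, abs_div, abs_of_pos hm1, sub_sub_sub_cancel_right, gauge, div_mul_div_comm,
    div_le_div_iff₀ hm1 (mul_pos hm1 (by linarith [hu.1, hv.1]))]
  have := mul_le_mul_of_nonneg_left (by linarith [hu.2, hv.2] : u + v ≤ 2 * m)
    (mul_nonneg (abs_nonneg (u - v)) hm1.le)
  linarith

lemma contDiffOn_chanRho (hm : 2 ≤ m) : ContDiffOn ℝ 1 (chanRho m) (Icc 0 1) := by
  have hM := two_le_cast hm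
  unfold chanRho
  refine ContDiffOn.div (by fun_prop) (by fun_prop) fun y hy => ?_
  have hu := (coord_mem hm hy).1
  have : 0 < ((m : ℝ) - 1) * y + m := by linarith
  positivity

/-- A probability measure on `[0, 1]` with `C²` distribution function `G` has a nonnegative
controlled density with respect to `γ_m`. -/
lemma exists_eq_densityMeasure (hm : 2 ≤ m) (μ : Measure ℝ) [IsProbabilityMeasure μ]
    (hsupp : μ (Icc (0 : ℝ) 1)ᶜ = 0) (hatom : μ {0} = 0) {G : ℝ → ℝ}
    (hG : ∀ x, G x = (μ (Iic x)).toReal) (hsmooth : ContDiffOn ℝ 2 G (Icc 0 1)) :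
    ∃ H lo hi L, Controlled m H lo hi L ∧ (∀ u ∈ Icc 1 (m : ℝ), 0 ≤ H u) ∧
      μ = densityMeasure m H := by
  have hM := two_le_cast hm
  have hm1 : 0 < (m : ℝ) - 1 := by linarith
  have hmaps : ∀ u ∈ Icc 1 (m : ℝ), (u - 1) / ((m : ℝ) - 1) ∈ Icc (0 : ℝ) 1 := fun u hu =>
    ⟨div_nonneg (by linarith [hu.1]) hm1.le, (div_le_one hm1).2 (by linarith [hu.2])⟩
  set D := derivWithin G (Icc 0 1)
  have hD : ContDiffOn ℝ 1 D (Icc 0 1) :=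
    hsmooth.derivWithin (uniqueDiffOn_Icc zero_lt_one) (by norm_num)
  have hmono : MonotoneOn G (Icc 0 1) := fun x _ y _ hxy => by
    rw [hG, hG]
    exact ENNReal.toReal_mono (measure_ne_top _ _) (measure_mono (Iic_subset_Iic.2 hxy))
  set H : ℝ → ℝ := fun u => D ((u - 1) / ((m : ℝ) - 1)) / chanRho m ((u - 1) / ((m : ℝ) - 1))
  obtain ⟨lo, hi, L, hc⟩ : ∃ lo hi L, Controlled m H lo hi L :=
    exists_controlled_of_contDiffOn hm
      (hD.div (contDiffOn_chanRho hm) fun y hy => (chanRho_pos hm hy).ne')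
  have h0 : ∀ u ∈ Icc 1 (m : ℝ), 0 ≤ H u := fun u hu =>
    div_nonneg hmono.derivWithin_nonneg (chanRho_pos hm (hmaps u hu)).le
  refine ⟨H, lo, hi, L, hc, h0, Measure.ext_of_Iic _ _ fun x => ?_⟩
  have key : ∀ x ∈ Icc (0 : ℝ) 1, μ (Iic x) = densityMeasure m H (Iic x) := by
    intro x hx
    have hG0 : G 0 = 0 := by
      rw [hG, ← measure_inter_conull hsupp, Iic_inter_Icc_of_le_one zero_le_one, Icc_self,
        hatom, ENNReal.toReal_zero]
    have hftc : ∫ y in (0 : ℝ)..x, D y = G x - G 0 := by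
      refine intervalIntegral.integral_eq_sub_of_hasDerivAt_of_le hx.1
        (hsmooth.continuousOn.mono (Icc_subset_Icc_right hx.2)) (fun y hy => ?_)
        ((hD.continuousOn.mono (Icc_subset_Icc_right hx.2)).intervalIntegrable_of_Icc hx.1)
      have hy' : y ∈ Ioo (0 : ℝ) 1 := ⟨hy.1, hy.2.trans_le hx.2⟩
      exact ((hsmooth.differentiableOn (by norm_num) y
        (Ioo_subset_Icc_self hy')).hasDerivWithinAt).hasDerivAt (Icc_mem_nhds hy'.1 hy'.2)
    rw [densityMeasure_Iic hm (hc.continuousOn hM) h0 hx,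
      ← ENNReal.ofReal_toReal (measure_ne_top μ (Iic x)), ← hG]
    congr 1
    rw [hG0, sub_zero] at hftc
    rw [← hftc]
    refine intervalIntegral.integral_congr fun y hy => ?_
    rw [uIcc_of_le hx.1] at hy
    have hρ := (chanRho_pos hm ⟨hy.1, hy.2.trans hx.2⟩).ne'
    have e : (((m : ℝ) - 1) * y + 1 - 1) / ((m : ℝ) - 1) = y := by field_simp; ring
    simp only [H, e]
    rw [mul_div_cancel₀ _ hρ]
  rcases lt_or_ge x 0 with hx | hx
  · have : Iic x ⊆ (Icc (0 : ℝ) 1)ᶜ := fun y hy hy' => absurd (hy'.1.trans hy) hx.not_ge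
    rw [measure_mono_null this hsupp, measure_mono_null this (densityMeasure_compl m _)]
  · have hs : Iic x ∩ Icc 0 1 = Iic (min x 1) ∩ Icc 0 1 := by
      ext y
      simp only [mem_inter_iff, mem_Iic, mem_Icc, le_min_iff]
      tauto
    rw [← measure_inter_conull hsupp, ← measure_inter_conull (densityMeasure_compl m _), hs,
      measure_inter_conull hsupp, measure_inter_conull (densityMeasure_compl m _)]
    exact key _ ⟨le_min hx zero_le_one, min_le_right _ _⟩

end Limit

end Chan

/-- if `μ` is a non-atomic Borel probability measure on `[0,1]` whose
distribution function `F_0(x) = μ([0,x])` is twice continuously differentiable on `[0,1]`,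
then for every `x ∈ [0,1]`, `μ{t : τ_mⁿ(t) ≤ x} → γ_m([0,x])` as `n → ∞`. -/
theorem chan_limit_distribution (m : ℕ) (hm : 2 ≤ m)
    (μ : MeasureTheory.Measure ℝ) [MeasureTheory.IsProbabilityMeasure μ]
    (hsupp : μ (Set.Icc (0 : ℝ) 1)ᶜ = 0)
    (hatom : ∀ x : ℝ, μ {x} = 0)
    (F : ℕ → ℝ → ℝ)
    (hF : ∀ n : ℕ, ∀ x : ℝ,
      F n x = (μ {t | t ∈ Set.Icc (0 : ℝ) 1 ∧ (chanTau m)^[n] t ≤ x}).toReal)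
    (hsmooth : ContDiffOn ℝ 2 (F 0) (Set.Icc (0 : ℝ) 1)) :
    ∀ x ∈ Set.Icc (0 : ℝ) 1,
      Filter.Tendsto (fun n : ℕ => F n x) Filter.atTop
        (nhds ((chanGamma m (Set.Icc 0 x)).toReal)) := by
  have e : ∀ n x, F n x = (μ ((chanTau m)^[n] ⁻¹' Iic x)).toReal := fun n x => by
    rw [hF, ← measure_inter_conull (s := _ ⁻¹' _) hsupp, inter_comm]
    rfl
  obtain ⟨H, lo, hi, L, hc, h0, rfl⟩ :=
    Chan.exists_eq_densityMeasure hm μ hsupp (hatom 0) (e 0) hsmooth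
  intro x hx
  simp_rw [e]
  rw [Chan.chanGamma_Icc hm hx]
  exact Chan.tendsto_integral_iterate hm hc h0 hx
end
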